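/- Let k be a field of characteristic zero, X = (x_{ij}) an m×n matrix of independent indeterminates with m ≤ n, R = k[x_{ij}] with homogeneous maximal ideal 𝔪, and I_t(X) the ideal generated by all t×t minors of X, 1 ≤ t ≤ m. Assume (min{t, m−t})! is invertible in k. Then for every non-negative integer N, the resurgence and asymptotic resurgence of the pair of families (I_t(X)^{(•)}, (𝔪^N I_t(X))^•) both equal (N+t)(m−t+1)/m; that is, sup{ s/r : s, r positive integers, I_t(X)^{(s)} ⊄ 𝔪^{Nr} I_t(X)^r } = sup{ s/r : I_t(X)^{(sT)} ⊄ 𝔪^{NrT} I_t(X)^{rT} for all sufficiently large T } = (N+t)(m−t+1)/m. -/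

import Mathlib

open MvPolynomial Filter

/-- The `s`-th symbolic power of an ideal: the intersection over the associated primes `p` of
`R ⧸ I` of the contractions of `I^s` localized at `p`. -/
noncomputable def symbolicPower {R : Type*} [CommRing R] (I : Ideal R) (s : ℕ) : Ideal R :=
  ⨅ p : {p : Ideal R // p ∈ associatedPrimes R (R ⧸ I)},
    letI : p.1.IsPrime := p.2.isPrime
    Ideal.comap (algebraMap R (Localization.AtPrime p.1))
      (Ideal.map (algebraMap R (Localization.AtPrime p.1)) (I ^ s))

/-- The resurgence of a pair of families of ideals:
`ρ(a_•, b_•) = sup { s/r : a_s ⊄ b_r }`. -/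
noncomputable def resurgencePair {R : Type*} [CommRing R] (a b : ℕ → Ideal R) : ℝ :=
  sSup {x : ℝ | ∃ s r : ℕ, 0 < s ∧ 0 < r ∧ x = (s : ℝ) / r ∧ ¬ a s ≤ b r}

/-- The asymptotic resurgence of a pair of families of ideals:
`ρ̂(a_•, b_•) = sup { s/r : a_{sT} ⊄ b_{rT} for all T ≫ 0 }`. -/
noncomputable def asympResurgencePair {R : Type*} [CommRing R] (a b : ℕ → Ideal R) : ℝ :=
  sSup {x : ℝ | ∃ s r : ℕ, 0 < s ∧ 0 < r ∧ x = (s : ℝ) / r ∧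
    ∀ᶠ T in atTop, ¬ a (s * T) ≤ b (r * T)}

/-- The ideal `I_t(X)` generated by the `t × t` minors of the generic `m × n` matrix
`X = (x_{ij})` of indeterminates. -/
noncomputable def genericMinors (K : Type*) [Field K] (m n t : ℕ) :
    Ideal (MvPolynomial (Fin m × Fin n) K) :=
  Ideal.span {d | ∃ (r : Fin t → Fin m) (c : Fin t → Fin n),
    Function.Injective r ∧ Function.Injective c ∧
    d = Matrix.det (Matrix.of fun i j =>
      (MvPolynomial.X (r i, c j) : MvPolynomial (Fin m × Fin n) K))}


/-! ### Balancing -/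

/-- exchange of the `i`-th entry of `w.1` with the `j`-th entry of `w.2` -/
def exch {ι : Type*} {a b : ℕ} (i : Fin a) (j : Fin b) (w : (Fin a → ι) × (Fin b → ι)) :
    (Fin a → ι) × (Fin b → ι) :=
  (Function.update w.1 i (w.2 j), Function.update w.2 j (w.1 i))

theorem exch_exch {ι : Type*} {a b : ℕ} (i : Fin a) (j : Fin b) (w : (Fin a → ι) × (Fin b → ι)) :
    exch i j (exch i j w) = w := by
  rcases w with ⟨A, B⟩
  simp [exch]

theorem exch_involutive {ι : Type*} {a b : ℕ} (i : Fin a) (j : Fin b) :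
    Function.Involutive (exch (ι := ι) i j) := exch_exch i j

theorem sum_exch {ι : Type*} [Fintype ι] {a b : ℕ} (i : Fin a) (j : Fin b)
    (F : (Fin a → ι) × (Fin b → ι) → ℚ) : ∑ w, F (exch i j w) = ∑ w, F w :=
  Equiv.sum_comp (exch_involutive i j).toPerm F

theorem exch_exch_ne {ι : Type*} {a b : ℕ} (i : Fin a) (j k : Fin b) (h : j ≠ k)
    (w : (Fin a → ι) × (Fin b → ι)) :
    exch i j (exch i k w) = ((exch i j w).1, (exch i j w).2 ∘ Equiv.swap j k) := by
  rcases w with ⟨A, B⟩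
  simp only [exch, Prod.mk.injEq, Function.update_idem, Function.update_self]
  refine ⟨by simp [h], ?_⟩
  funext x
  simp only [Function.comp, Function.update_apply, Equiv.swap_apply_def]
  split_ifs <;> simp_all

theorem exch_pos {ι : Type*} [Fintype ι] {a b : ℕ} (φ : (Fin a → ι) × (Fin b → ι) → ℚ)
    (halt : ∀ A B (j k : Fin b), j ≠ k → φ (A, B ∘ Equiv.swap j k) = - φ (A, B)) (i : Fin a) :
    ∑ j : Fin b, ∑ w, φ w * φ (exch i j w) ≤ ∑ w, φ w * φ w := by
  set ψ : (Fin a → ι) × (Fin b → ι) → ℚ := fun w => φ w - ∑ j, φ (exch i j w) with hψ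
  have h1 : ∀ k w, ψ (exch i k w) = - ψ w := by
    intro k w
    simp only [hψ]
    rw [← Finset.add_sum_erase _ _ (Finset.mem_univ k),
      ← Finset.add_sum_erase (a := k) Finset.univ (fun j => φ (exch i j w)) (Finset.mem_univ k),
      exch_exch]
    have : ∑ x ∈ Finset.univ.erase k, φ (exch i x (exch i k w))
        = - ∑ x ∈ Finset.univ.erase k, φ (exch i x w) := by
      rw [← Finset.sum_neg_distrib]
      refine Finset.sum_congr rfl fun x hx => ?_
      have hx' : x ≠ k := (Finset.mem_erase.1 hx).1
      rw [exch_exch_ne i x k hx', halt _ _ _ _ hx']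
    rw [this]; ring
  have h2 : ∑ w, ψ w * ψ w = (1 + b) * ∑ w, ψ w * φ w := by
    have : ∀ w, ψ w * ψ w = ψ w * φ w - ∑ j, ψ w * φ (exch i j w) := by
      intro w
      conv_lhs => rw [show ψ w * ψ w = ψ w * (φ w - ∑ j, φ (exch i j w)) from rfl]
      rw [mul_sub, Finset.mul_sum]
    simp_rw [this]
    rw [Finset.sum_sub_distrib, Finset.sum_comm]
    have : ∀ j, ∑ w, ψ w * φ (exch i j w) = - ∑ w, ψ w * φ w := by
      intro j
      rw [← sum_exch i j, ← Finset.sum_neg_distrib]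
      refine Finset.sum_congr rfl fun w _ => ?_
      rw [exch_exch, h1]; ring
    simp_rw [this]
    simp
    ring
  have h3 : 0 ≤ ∑ w, ψ w * ψ w := Finset.sum_nonneg fun w _ => mul_self_nonneg _
  rw [h2] at h3
  have h4 : 0 ≤ ∑ w, ψ w * φ w := by
    refine nonneg_of_mul_nonneg_right h3 (by positivity)
  have h5 : ∑ w, ψ w * φ w = ∑ w, φ w * φ w - ∑ j : Fin b, ∑ w, φ w * φ (exch i j w) := by
    rw [Finset.sum_comm, ← Finset.sum_sub_distrib]
    refine Finset.sum_congr rfl fun w _ => ?_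
    rw [← Finset.mul_sum, ← mul_sub, mul_comm]
  linarith

theorem exch_zero {ι : Type*} [Fintype ι] {a b : ℕ} (hab : a < b)
    (φ : (Fin a → ι) × (Fin b → ι) → ℚ)
    (halt : ∀ A B (j k : Fin b), j ≠ k → φ (A, B ∘ Equiv.swap j k) = - φ (A, B))
    (hrel : ∀ j w, φ w = ∑ i, φ (exch i j w)) : ∀ w, φ w = 0 := by
  have h1 : ∑ i : Fin a, ∑ j : Fin b, ∑ w, φ w * φ (exch i j w) ≤ a * ∑ w, φ w * φ w := by
    refine (Finset.sum_le_sum fun i _ => exch_pos φ halt i).trans ?_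
    simp
  have h2 : ∑ i : Fin a, ∑ j : Fin b, ∑ w, φ w * φ (exch i j w) = b * ∑ w, φ w * φ w := by
    rw [Finset.sum_comm]
    have : ∀ j, ∑ i : Fin a, ∑ w, φ w * φ (exch i j w) = ∑ w, φ w * φ w := by
      intro j
      rw [Finset.sum_comm]
      refine Finset.sum_congr rfl fun w _ => ?_
      rw [← Finset.mul_sum, ← hrel j w]
    simp [this]
  have h3 : (a : ℚ) < b := by exact_mod_cast hab
  have h0 : 0 ≤ ∑ w, φ w * φ w := Finset.sum_nonneg fun w _ => mul_self_nonneg _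
  have h4 : ∑ w, φ w * φ w = 0 := by nlinarith
  intro w
  have := (Finset.sum_eq_zero_iff_of_nonneg (fun w _ => mul_self_nonneg (φ w))).1 h4 w
    (Finset.mem_univ _)
  simpa using this

/-- minors -/
noncomputable def mnr (K : Type*) [Field K] {m n a : ℕ} (A : Fin a → Fin m) (C : Fin a → Fin n) :
    MvPolynomial (Fin m × Fin n) K :=
  Matrix.det (Matrix.of fun i j => (X (A i, C j) : MvPolynomial (Fin m × Fin n) K))

section
variable {K : Type*} [Field K] {m n : ℕ}

theorem mnr_mem {a : ℕ} (A : Fin a → Fin m) (C : Fin a → Fin n) :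
    mnr K A C ∈ genericMinors K m n a := by
  by_cases hA : Function.Injective A
  · by_cases hC : Function.Injective C
    · exact Ideal.subset_span ⟨A, C, hA, hC, rfl⟩
    · have : mnr K A C = 0 := by
        simp only [Function.Injective, not_forall] at hC
        obtain ⟨i, j, h, hne⟩ := hC
        exact Matrix.det_zero_of_column_eq hne (fun k => by simp [h])
      rw [this]; exact zero_mem _
  · have : mnr K A C = 0 := by
      simp only [Function.Injective, not_forall] at hA
      obtain ⟨i, j, h, hne⟩ := hA
      exact Matrix.det_zero_of_row_eq hne (by funext k; simp [h])
    rw [this]; exact zero_mem _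

theorem minors_le {a : ℕ} {J : Ideal (MvPolynomial (Fin m × Fin n) K)}
    (h : ∀ (A : Fin a → Fin m) (C : Fin a → Fin n), mnr K A C ∈ J) : genericMinors K m n a ≤ J := by
  refine Ideal.span_le.2 ?_
  rintro _ ⟨A, C, _, _, rfl⟩
  exact h A C

theorem mnr_perm {a : ℕ} (A : Fin a → Fin m) (C : Fin a → Fin n) (σ : Equiv.Perm (Fin a)) :
    mnr K (A ∘ σ) C = (Equiv.Perm.sign σ : ℤ) * mnr K A C := by
  have := Matrix.det_permute σ
    (Matrix.of fun i j => (X (A i, C j) : MvPolynomial (Fin m × Fin n) K))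
  exact this

theorem mnr_cons_succAbove {a : ℕ} (A : Fin a → Fin m) (C : Fin a → Fin n) (v : Fin m)
    (i : Fin a) :
    mnr K (fun x => (Fin.cons v A : Fin (a+1) → Fin m) (i.succ.succAbove x)) C
      = (-1) ^ (i : ℕ) * mnr K (Function.update A i v) C := by
  have h : Function.update A i v =
      (fun x => (Fin.cons v A : Fin (a+1) → Fin m) (i.succ.succAbove x)) ∘ (Fin.cycleRange i) := by
    funext x
    simp only [Function.comp, Fin.succAbove_cycleRange]
    by_cases hx : x = i
    · subst hx; simp
    · rw [Equiv.swap_apply_of_ne_of_ne (Fin.succ_ne_zero x) (by simpa using hx)]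
      simp [hx]
  rw [h, mnr_perm, Fin.sign_cycleRange]
  push_cast
  rw [← mul_assoc, ← mul_pow]
  simp

theorem mnr_rel {a b : ℕ} (A : Fin a → Fin m) (C : Fin a → Fin n)
    (B : Fin (b+1) → Fin m) (D : Fin (b+1) → Fin n) (j : Fin (b+1)) :
    mnr K A C * mnr K B D - ∑ i, mnr K (Function.update A i (B j)) C *
        mnr K (Function.update B j (A i)) D
      ∈ genericMinors K m n (a+1) * genericMinors K m n b := by
  have hz : ∑ y : Fin (b+1), (-1) ^ (j + y : ℕ) * (mnr K (Fin.cons (B j) A) (Fin.cons (D y) C) *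
      mnr K (fun x => B (j.succAbove x)) (fun x => D (y.succAbove x)))
      ∈ genericMinors K m n (a+1) * genericMinors K m n b :=
    Ideal.sum_mem _ fun y _ => Ideal.mul_mem_left _ _ (Ideal.mul_mem_mul (mnr_mem _ _) (mnr_mem _ _))
  have hexp : ∀ (B' : Fin (b+1) → Fin m), mnr K B' D = ∑ y : Fin (b+1), (-1) ^ (j + y : ℕ) *
      X (B' j, D y) * mnr K (fun x => B' (j.succAbove x)) (fun x => D (y.succAbove x)) := by
    intro B'
    exact Matrix.det_succ_row (Matrix.of fun i j => (X (B' i, D j) : MvPolynomial (Fin m × Fin n) K)) j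
  have hcol : ∀ y, mnr K (Fin.cons (B j) A : Fin (a+1) → Fin m) (Fin.cons (D y) C)
      = X (B j, D y) * mnr K A C - ∑ i, X (A i, D y) * mnr K (Function.update A i (B j)) C := by
    intro y
    have := Matrix.det_succ_column_zero (Matrix.of fun i k => (X ((Fin.cons (B j) A : Fin (a+1) → Fin m) i,
      (Fin.cons (D y) C : Fin (a+1) → Fin n) k) : MvPolynomial (Fin m × Fin n) K))
    rw [mnr, this, Fin.sum_univ_succ, sub_eq_add_neg, ← Finset.sum_neg_distrib]
    refine congrArg₂ (· + ·) ?_ ?_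
    · simp [mnr]; rfl
    · refine Finset.sum_congr rfl fun i _ => ?_
      have h2 := mnr_cons_succAbove (K := K) A C (B j) i
      have h3 : ((Matrix.of fun i k => (X ((Fin.cons (B j) A : Fin (a+1) → Fin m) i,
        (Fin.cons (D y) C : Fin (a+1) → Fin n) k) : MvPolynomial (Fin m × Fin n) K)).submatrix
          i.succ.succAbove Fin.succ).det
          = mnr K (fun x => (Fin.cons (B j) A : Fin (a+1) → Fin m) (i.succ.succAbove x)) C := rfl
      rw [h3, h2]
      simp only [Matrix.of_apply, Fin.cons_succ, Fin.cons_zero, Fin.val_succ, pow_succ]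
      have : ((-1 : MvPolynomial (Fin m × Fin n) K) ^ (i : ℕ)) * (-1) ^ (i : ℕ) = 1 := by
        rw [← mul_pow]; simp
      linear_combination (- X (A i, D y) * mnr K (Function.update A i (B j)) C) * this
  convert hz using 1
  simp_rw [hcol]
  rw [hexp B]
  have h4 : ∀ i, mnr K (Function.update B j (A i)) D = ∑ y : Fin (b+1), (-1) ^ (j + y : ℕ) *
      X (A i, D y) * mnr K (fun x => B (j.succAbove x)) (fun x => D (y.succAbove x)) := by
    intro i
    rw [hexp]
    simp
  simp_rw [h4, Finset.mul_sum]
  rw [Finset.sum_comm, ← Finset.sum_sub_distrib]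
  refine Finset.sum_congr rfl fun y _ => ?_
  rw [sub_mul, mul_sub, Finset.sum_mul, Finset.mul_sum]
  refine congrArg₂ (· - ·) ?_ ?_
  · ring
  · refine Finset.sum_congr rfl fun i _ => ?_
    ring

theorem minors_balance [CharZero K] {a b : ℕ} (hab : a ≤ b) :
    genericMinors K m n a * genericMinors K m n (b+1)
      ≤ genericMinors K m n (a+1) * genericMinors K m n b := by
  set J := genericMinors K m n (a+1) * genericMinors K m n b with hJ
  have key : ∀ (C : Fin a → Fin n) (D : Fin (b+1) → Fin n) (w : (Fin a → Fin m) × (Fin (b+1) → Fin m)),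
      mnr K w.1 C * mnr K w.2 D ∈ J := by
    intro C D w
    by_contra hcon
    obtain ⟨f, hf, hJf⟩ := Submodule.exists_le_ker_of_notMem (K := ℚ)
      (p := J.restrictScalars ℚ) (v := mnr K w.1 C * mnr K w.2 D) (by simpa using hcon)
    have := exch_zero (ι := Fin m) (a := a) (b := b+1) (by omega)
      (fun w => f (mnr K w.1 C * mnr K w.2 D)) ?_ ?_ w
    · exact hf this
    · intro A B j k hjk
      simp only [mnr_perm, Equiv.Perm.sign_swap hjk]
      rw [← map_neg]; congr 1; push_cast; ring
    · intro j w
      have h := hJf (show _ ∈ J.restrictScalars ℚ from mnr_rel (K := K) w.1 C w.2 D j)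
      rw [LinearMap.mem_ker, map_sub, map_sum, sub_eq_zero] at h
      exact h
  rw [genericMinors, genericMinors, Ideal.span_mul_span', Ideal.span_le]
  rintro _ ⟨_, ⟨A, C, _, _, rfl⟩, _, ⟨B, D, _, _, rfl⟩, rfl⟩
  exact key C D (A, B)

/-- the maximal ideal -/
noncomputable abbrev mm (K : Type*) [Field K] (m n : ℕ) : Ideal (MvPolynomial (Fin m × Fin n) K) :=
  Ideal.span (Set.range X)

theorem minors_succ_le (a : ℕ) :
    genericMinors K m n (a+1) ≤ mm K m n * genericMinors K m n a := by
  refine minors_le fun A C => ?_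
  have := Matrix.det_succ_column_zero (Matrix.of fun i k => (X (A i, C k) : MvPolynomial (Fin m × Fin n) K))
  rw [mnr, this]
  refine Ideal.sum_mem _ fun i _ => ?_
  exact Ideal.mul_mem_mul (Ideal.mul_mem_left _ _ (Ideal.subset_span ⟨_, rfl⟩))
    (mnr_mem (fun x => A (i.succAbove x)) (fun x => C x.succ))

theorem minors_zero : genericMinors K m n 0 = ⊤ := by
  rw [Ideal.eq_top_iff_one]
  have := mnr_mem (K := K) (m := m) (n := n) (a := 0) Fin.elim0 Fin.elim0
  simpa [mnr] using this

theorem minors_add_le (a c : ℕ) :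
    genericMinors K m n (a+c) ≤ mm K m n ^ c * genericMinors K m n a := by
  induction c with
  | zero => simp
  | succ c ih =>
    refine (minors_succ_le (a+c)).trans ?_
    rw [pow_succ', mul_assoc]
    exact Ideal.mul_mono_right ih

theorem minors_le_pow (a : ℕ) : genericMinors K m n a ≤ mm K m n ^ a := by
  have := minors_add_le (K := K) (m := m) (n := n) 0 a
  rw [minors_zero] at this
  simpa using this

theorem prod_minors_le [CharZero K] (t r : ℕ) : ∀ (D : ℕ) (σ : Fin r → ℕ),
    ∑ i, (t - σ i) = D → r * t ≤ ∑ i, σ i →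
    ∏ i, genericMinors K m n (σ i) ≤ mm K m n ^ (∑ i, σ i - r * t) * genericMinors K m n t ^ r := by
  intro D
  induction D with
  | zero =>
    intro σ h0 hs
    have h : ∀ i, t ≤ σ i := by
      intro i
      have := (Finset.sum_eq_zero_iff.1 h0) i (Finset.mem_univ _)
      omega
    have h1 : ∏ i, genericMinors K m n (σ i) ≤ ∏ i : Fin r, (mm K m n ^ (σ i - t) * genericMinors K m n t) := by
      refine Finset.prod_le_prod' fun i _ => ?_
      have := minors_add_le (K := K) (m := m) (n := n) t (σ i - t)
      rwa [Nat.add_sub_cancel' (h i)] at this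
    refine h1.trans ?_
    rw [Finset.prod_mul_distrib, Finset.prod_pow_eq_pow_sum]
    simp only [Finset.prod_const, Finset.card_univ, Fintype.card_fin]
    have : ∑ i, (σ i - t) = ∑ i, σ i - r * t := by
      rw [Finset.sum_tsub_distrib _ (fun i _ => h i)]; simp
    rw [this]
  | succ D ih =>
    intro σ h0 hs
    have ⟨i, hi⟩ : ∃ i, σ i < t := by
      by_contra hcon
      push Not at hcon
      have : ∑ i, (t - σ i) = 0 := Finset.sum_eq_zero fun i _ => Nat.sub_eq_zero_of_le (hcon i)
      omega
    have ⟨j, hj⟩ : ∃ j, t < σ j := by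
      by_contra hcon
      push Not at hcon
      have : ∑ i, σ i < ∑ i : Fin r, t := Finset.sum_lt_sum (fun k _ => hcon k) ⟨i, Finset.mem_univ _, hi⟩
      simp at this
      omega
    have hij : i ≠ j := by rintro rfl; omega
    set τ : Fin r → ℕ := Function.update (Function.update σ i (σ i + 1)) j (σ j - 1) with hτ
    have hτi : τ i = σ i + 1 := by simp [hτ, hij]
    have hτj : τ j = σ j - 1 := by simp [hτ]
    have hτk : ∀ k, k ≠ i → k ≠ j → τ k = σ k := by intro k h1 h2; simp [hτ, h1, h2]
    have hji : j ∈ Finset.univ.erase i := by simp [hij.symm]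
    have hmem : ∀ k ∈ (Finset.univ.erase i).erase j, τ k = σ k := by
      intro k hk
      simp at hk
      exact hτk k hk.2 hk.1
    have hsum : ∑ k, τ k = ∑ k, σ k := by
      rw [← Finset.add_sum_erase _ _ (Finset.mem_univ i), ← Finset.add_sum_erase _ _ hji,
        ← Finset.add_sum_erase _ (fun x => σ x) (Finset.mem_univ i),
        ← Finset.add_sum_erase _ (fun x => σ x) hji,
        Finset.sum_congr rfl hmem, hτi, hτj]
      have : ∀ Z, σ i + 1 + (σ j - 1 + Z) = σ i + (σ j + Z) := by omega
      exact this _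
    have hdef : ∑ k, (t - τ k) = D := by
      rw [← Finset.add_sum_erase _ _ (Finset.mem_univ i), ← Finset.add_sum_erase _ _ hji] at h0 ⊢
      rw [Finset.sum_congr rfl (fun k hk => by rw [hmem k hk]), hτi, hτj]
      omega
    have := ih τ hdef (by rw [hsum]; exact hs)
    rw [hsum] at this
    refine le_trans ?_ this
    rw [← Finset.mul_prod_erase _ _ (Finset.mem_univ i), ← Finset.mul_prod_erase _ _ hji,
      ← Finset.mul_prod_erase _ (fun k => genericMinors K m n (τ k)) (Finset.mem_univ i),
      ← Finset.mul_prod_erase _ (fun k => genericMinors K m n (τ k)) hji,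
      Finset.prod_congr rfl (fun k hk => by rw [← hmem k hk]), ← mul_assoc, ← mul_assoc]
    refine Ideal.mul_mono_left ?_
    rw [hτi, hτj]
    obtain ⟨b, hb⟩ : ∃ b, σ j = b + 1 := ⟨σ j - 1, by omega⟩
    rw [hb]
    exact minors_balance (by omega)
end


/-! ### Linear substitutions and the apolar form -/

/-- linear substitution -/
noncomputable def lsub {σ K : Type*} [Fintype σ] [Field K] (A : σ → σ → K) :
    MvPolynomial σ K →ₐ[K] MvPolynomial σ K :=
  aeval fun p => ∑ q, C (A p q) * X q

theorem lsub_X {σ K : Type*} [Fintype σ] [Field K] (A : σ → σ → K) (p : σ) :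
    lsub A (X p) = ∑ q, C (A p q) * X q := by simp [lsub]

theorem constCoeff_lsub {σ K : Type*} [Fintype σ] [Field K] (A : σ → σ → K) (f : MvPolynomial σ K) :
    constantCoeff (lsub A f) = constantCoeff f := by
  induction f using MvPolynomial.induction_on with
  | C a => simp [lsub]
  | add p q hp hq => simp [hp, hq]
  | mul_X p i hp => simp [lsub_X]

theorem pderiv_lsub {σ K : Type*} [Fintype σ] [Field K] (A : σ → σ → K)
    (p : σ) (f : MvPolynomial σ K) :
    pderiv p (lsub A f) = ∑ q, C (A q p) * lsub A (pderiv q f) := by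
  classical
  induction f using MvPolynomial.induction_on with
  | C a => simp [lsub]
  | add f g hf hg => simp [hf, hg, mul_add, Finset.sum_add_distrib]
  | mul_X f i hf =>
    have h1 : pderiv p (∑ q, C (A i q) * X q) = C (A i p) := by
      rw [map_sum, Finset.sum_eq_single p]
      · rw [pderiv_C_mul, pderiv_X_self, mul_one]
      · intro b _ hb
        rw [pderiv_C_mul, pderiv_X_of_ne hb, mul_zero]
      · simp
    rw [map_mul, pderiv_mul, hf, lsub_X, h1]
    simp_rw [pderiv_mul, map_add, map_mul, mul_add, Finset.sum_add_distrib]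
    congr 1
    · rw [lsub_X, Finset.sum_mul]
      refine Finset.sum_congr rfl fun q _ => by ring
    · rw [Finset.sum_eq_single i]
      · rw [pderiv_X_self, map_one]; ring
      · intro b _ hb
        rw [pderiv_X_of_ne hb.symm, map_zero]; simp
      · simp

/-- multi-factorial -/
def mfac {σ : Type*} [Fintype σ] (α : σ →₀ ℕ) : ℚ := ∏ p, ((α p).factorial : ℚ)

theorem mfac_pos {σ : Type*} [Fintype σ] (α : σ →₀ ℕ) : 0 < mfac α :=
  Finset.prod_pos fun p _ => by exact_mod_cast Nat.factorial_pos _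

theorem mfac_succ {σ : Type*} [Fintype σ] (α : σ →₀ ℕ) (p : σ) :
    mfac (α + Finsupp.single p 1) = (α p + 1) * mfac α := by
  classical
  rw [mfac, mfac, ← Finset.mul_prod_erase _ _ (Finset.mem_univ p),
    ← Finset.mul_prod_erase _ (fun q => ((α q).factorial : ℚ)) (Finset.mem_univ p), ← mul_assoc]
  congr 1
  · simp [Nat.factorial_succ]
  · refine Finset.prod_congr rfl fun q hq => ?_
    simp at hq
    simp [Ne.symm hq]

/-- the apolar form -/
noncomputable def ip {σ : Type*} [Fintype σ] :
    MvPolynomial σ ℚ →ₗ[ℚ] MvPolynomial σ ℚ →ₗ[ℚ] ℚ :=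
  (basisMonomials σ ℚ).constr ℚ (fun α => mfac α • lcoeff ℚ α)

theorem ip_monomial {σ : Type*} [Fintype σ] (α : σ →₀ ℕ) (a : ℚ) (g : MvPolynomial σ ℚ) :
    ip (monomial α a) g = a * (mfac α * coeff α g) := by
  have h : (monomial α a : MvPolynomial σ ℚ) = a • basisMonomials σ ℚ α := by
    simp [smul_monomial]
  rw [h, map_smul, ip, Module.Basis.constr_basis]
  simp [lcoeff]

theorem ip_eq {σ : Type*} [Fintype σ] (f g : MvPolynomial σ ℚ) :
    ip f g = ∑ α ∈ f.support, coeff α f * (mfac α * coeff α g) := by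
  conv_lhs => rw [f.as_sum, map_sum, LinearMap.sum_apply]
  simp_rw [ip_monomial]

theorem ip_symm {σ : Type*} [Fintype σ] (f g : MvPolynomial σ ℚ) : ip f g = ip g f := by
  classical
  rw [ip_eq, ip_eq]
  rw [Finset.sum_subset (Finset.subset_union_left (s₂ := g.support)),
    Finset.sum_subset (Finset.subset_union_right (s₁ := f.support) (s₂ := g.support))]
  · refine Finset.sum_congr rfl fun α _ => by ring
  · intro α _ h
    rw [notMem_support_iff.1 h]; simp
  · intro α _ h
    rw [notMem_support_iff.1 h]; simp

theorem ip_self {σ : Type*} [Fintype σ] {f : MvPolynomial σ ℚ} (h : ip f f = 0) : f = 0 := by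
  rw [ip_eq] at h
  have h0 : ∀ α ∈ f.support, 0 ≤ coeff α f * (mfac α * coeff α f) := by
    intro α _
    have := mul_nonneg (mfac_pos α).le (mul_self_nonneg (coeff α f))
    linarith
  rw [Finset.sum_eq_zero_iff_of_nonneg h0] at h
  ext α
  by_contra hα
  have := h α (mem_support_iff.2 hα)
  have h2 := (mfac_pos α).ne'
  simp at hα
  simp [hα, h2] at this

theorem mono_mul_X {σ K : Type*} [Field K] (α : σ →₀ ℕ) (a : K) (p : σ) :
    monomial α a * X p = monomial (α + Finsupp.single p 1) a := by
  rw [X, monomial_mul, mul_one]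

theorem ip_X_mul {σ : Type*} [Fintype σ] (p : σ) (f g : MvPolynomial σ ℚ) :
    ip (f * X p) g = ip f (pderiv p g) := by
  induction f using MvPolynomial.monomial_add_induction_on with
  | C a =>
    rw [← monomial_zero', mono_mul_X, ip_monomial, ip_monomial, coeff_pderiv, mfac_succ]
    simp
  | monomial_add α a f _ _ hf =>
    rw [add_mul, map_add, LinearMap.add_apply, hf, map_add, LinearMap.add_apply, mono_mul_X,
      ip_monomial, ip_monomial, coeff_pderiv, mfac_succ]
    ring

theorem ip_lsub {σ : Type*} [Fintype σ] (A : σ → σ → ℚ) (f g : MvPolynomial σ ℚ) :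
    ip (lsub A f) g = ip f (lsub (fun p q => A q p) g) := by
  induction f using MvPolynomial.induction_on generalizing g with
  | C a =>
    have : lsub A (C a) = C a := by simp [lsub]
    rw [this, ← monomial_zero', ip_monomial, ip_monomial]
    have := constCoeff_lsub (fun p q => A q p) g
    rw [constantCoeff_eq] at this
    rw [this]
  | add f h hf hh => simp [hf, hh]
  | mul_X f i hf =>
    rw [map_mul, lsub_X, ip_X_mul, pderiv_lsub, Finset.mul_sum, map_sum, map_sum,
      LinearMap.sum_apply]
    refine Finset.sum_congr rfl fun q _ => ?_
    rw [C_mul', C_mul', mul_smul_comm, map_smul, map_smul, LinearMap.smul_apply, ip_X_mul, hf]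

/-- orthogonal decomposition inside a finite-dimensional stable space -/
theorem exists_orth {σ : Type*} [Fintype σ] (J B : Submodule ℚ (MvPolynomial σ ℚ)) (hBJ : B ≤ J)
    [FiniteDimensional ℚ J] (h : ¬ J ≤ B) :
    ∃ f ∈ J, f ≠ 0 ∧ ∀ b ∈ B, ip b f = 0 := by
  have : FiniteDimensional ℚ B := Submodule.finiteDimensional_of_le hBJ
  let T : B →ₗ[ℚ] Module.Dual ℚ B := ((ip.compl₁₂ B.subtype B.subtype).flip)
  have hT : ∀ x y : B, T x y = ip (y : MvPolynomial σ ℚ) (x : MvPolynomial σ ℚ) := fun x y => rfl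
  have hinj : Function.Injective T := by
    rw [← LinearMap.ker_eq_bot, LinearMap.ker_eq_bot']
    intro x hx
    have : T x x = 0 := by rw [hx]; rfl
    rw [hT] at this
    exact Subtype.ext (ip_self this)
  have hsurj := (LinearMap.injective_iff_surjective_of_finrank_eq_finrank
    (Subspace.dual_finrank_eq (K := ℚ) (V := B)).symm).1 hinj
  obtain ⟨f, hfJ, hfB⟩ := Set.not_subset.1 h
  obtain ⟨b, hb⟩ := hsurj ((ip.flip f).comp B.subtype)
  refine ⟨f - b, J.sub_mem hfJ (hBJ b.2), ?_, ?_⟩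
  · intro h0
    apply hfB
    rw [sub_eq_zero.1 h0]
    exact b.2
  · intro c hc
    have := LinearMap.congr_fun hb ⟨c, hc⟩
    rw [hT] at this
    rw [map_sub, this]
    simp


/-! ### Torus weights -/

/-- torus substitution -/
noncomputable def tsub {σ ι K : Type*} [Field K] (w : σ → (ι →₀ ℕ)) (τ : ι → K) :
    MvPolynomial σ K →ₐ[K] MvPolynomial σ K :=
  aeval fun p => C (eval τ (monomial (w p) (1 : K))) * X p

theorem mono_add {ι K : Type*} [Field K] (τ : ι → K) (a b : ι →₀ ℕ) :
    eval τ (monomial (a + b) (1 : K)) = eval τ (monomial a (1 : K)) * eval τ (monomial b (1 : K)) := by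
  rw [← map_mul, monomial_mul, mul_one]

theorem tsub_monomial {σ ι K : Type*} [Field K] (w : σ → (ι →₀ ℕ)) (τ : ι → K) (α : σ →₀ ℕ) (a : K) :
    tsub w τ (monomial α a) =
      C (eval τ (monomial (Finsupp.weight w α) (1 : K))) * monomial α a := by
  have key : tsub w τ (monomial α 1) =
      C (eval τ (monomial (Finsupp.weight w α) (1 : K))) * monomial α 1 := by
    induction α using Finsupp.induction_linear with
    | zero => simp
    | add f g hf hg =>
      have : (monomial (f + g) (1 : K)) = monomial f 1 * monomial g 1 := by
        rw [monomial_mul, mul_one]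
      rw [this, map_mul, hf, hg, map_add, mono_add, C_mul]
      ring
    | single p k =>
      induction k with
      | zero => simp
      | succ k ih =>
        have : (monomial (Finsupp.single p (k+1)) (1 : K)) = monomial (Finsupp.single p k) 1 * X p := by
          rw [mono_mul_X, Finsupp.single_add]
        rw [this, map_mul, ih, Finsupp.single_add, map_add, mono_add, C_mul]
        simp only [tsub, aeval_X, Finsupp.weight_single, one_smul]
        ring
  have h : (monomial α a : MvPolynomial σ K) = C a * monomial α 1 := by
    rw [C_mul_monomial, mul_one]
  rw [h, map_mul, key]
  have : tsub w τ (C a) = C a := by simp [tsub]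
  rw [this]; ring

theorem tsub_homog {σ ι K : Type*} [Field K] (w : σ → (ι →₀ ℕ)) (τ : ι → K) {f : MvPolynomial σ K}
    {μ : ι →₀ ℕ} (hf : IsWeightedHomogeneous w f μ) :
    tsub w τ f = C (eval τ (monomial μ (1 : K))) * f := by
  conv_lhs => rw [f.as_sum]
  conv_rhs => rw [f.as_sum]
  rw [map_sum, Finset.mul_sum]
  refine Finset.sum_congr rfl fun α hα => ?_
  rw [tsub_monomial, hf (mem_support_iff.1 hα)]

theorem comp_mem {σ ι K : Type*} [Field K] [Infinite K] (w : σ → (ι →₀ ℕ))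
    (S : Submodule K (MvPolynomial σ K)) (hS : ∀ (τ : ι → K), ∀ f ∈ S, tsub w τ f ∈ S)
    {f : MvPolynomial σ K} (hf : f ∈ S) (μ : ι →₀ ℕ) : weightedHomogeneousComponent w μ f ∈ S := by
  classical
  by_contra hcon
  obtain ⟨l, hl, hSl⟩ := Submodule.exists_le_ker_of_notMem hcon
  apply hl
  set F : MvPolynomial ι K := ∑ α ∈ f.support,
    monomial (Finsupp.weight w α) (l (monomial α (coeff α f))) with hF
  have hF0 : F = 0 := by
    apply MvPolynomial.funext
    intro τ
    have h1 := hSl (hS τ f hf)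
    rw [LinearMap.mem_ker] at h1
    conv_lhs at h1 => rw [f.as_sum]
    rw [map_sum, map_sum] at h1
    rw [hF, map_sum, map_zero, ← h1]
    refine Finset.sum_congr rfl fun α _ => ?_
    rw [tsub_monomial, C_mul', map_smul, smul_eq_mul]
    have : monomial (Finsupp.weight w α) (l (monomial α (coeff α f)))
      = C (l (monomial α (coeff α f))) * monomial (Finsupp.weight w α) 1 := by
      rw [C_mul_monomial, mul_one]
    rw [this, map_mul, eval_C, mul_comm]
  have h2 : coeff μ F = l (weightedHomogeneousComponent w μ f) := by
    rw [hF, coeff_sum, weightedHomogeneousComponent_apply, map_sum, Finset.sum_filter]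
    refine Finset.sum_congr rfl fun α _ => ?_
    rw [coeff_monomial]
  rw [← h2, hF0, coeff_zero]

/-! ### Row and column substitutions -/

section
variable {K : Type*} [Field K] {m n : ℕ}

/-- substitution `X ↦ g X h` -/
noncomputable def gsub (g : Matrix (Fin m) (Fin m) K) (h : Matrix (Fin n) (Fin n) K) :
    MvPolynomial (Fin m × Fin n) K →ₐ[K] MvPolynomial (Fin m × Fin n) K :=
  lsub (fun p q => g p.1 q.1 * h q.2 p.2)

/-- torus weight -/
noncomputable def wt (p : Fin m × Fin n) : (Fin m ⊕ Fin n) →₀ ℕ :=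
  Finsupp.single (Sum.inl p.1) 1 + Finsupp.single (Sum.inr p.2) 1

theorem gsub_X (g : Matrix (Fin m) (Fin m) K) (h : Matrix (Fin n) (Fin n) K) (p : Fin m × Fin n) :
    gsub g h (X p) = ∑ q : Fin m × Fin n, C (g p.1 q.1 * h q.2 p.2) * X q := lsub_X _ _

theorem gsub_diag (τ : (Fin m ⊕ Fin n) → K) :
    gsub (Matrix.diagonal (fun i => τ (Sum.inl i))) (Matrix.diagonal (fun i => τ (Sum.inr i)))
      = tsub wt τ := by
  apply MvPolynomial.algHom_ext
  intro p
  rw [gsub_X, Finset.sum_eq_single p]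
  · have hX : ∀ i, eval τ (monomial (Finsupp.single i 1) (1 : K)) = τ i := fun i => eval_X i
    rw [tsub, aeval_X, wt, mono_add, hX, hX, Matrix.diagonal_apply_eq, Matrix.diagonal_apply_eq]
  · intro q _ hq
    by_cases h1 : p.1 = q.1
    · have h2 : q.2 ≠ p.2 := fun h => hq (Prod.ext h1.symm h)
      simp [Matrix.diagonal_apply_ne _ h2]
    · simp [Matrix.diagonal_apply_ne _ h1]
  · simp

theorem eval_gsub (g : Matrix (Fin m) (Fin m) K) (h : Matrix (Fin n) (Fin n) K)
    (M : Matrix (Fin m) (Fin n) K) (f : MvPolynomial (Fin m × Fin n) K) :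
    eval (fun p => M p.1 p.2) (gsub g h f) = eval (fun p => (g * M * h) p.1 p.2) f := by
  induction f using MvPolynomial.induction_on with
  | C a => simp [gsub, lsub]
  | add p q hp hq => simp [hp, hq]
  | mul_X f p hp =>
    rw [map_mul, map_mul, map_mul, hp, gsub_X]
    congr 1
    simp only [map_sum, map_mul, eval_C, eval_X, Matrix.mul_apply, Finset.sum_mul,
      Fintype.sum_prod_type]
    rw [Finset.sum_comm]
    refine Finset.sum_congr rfl fun i _ => Finset.sum_congr rfl fun j _ => ?_
    ring

/-- height of a monomial -/
noncomputable def hh : ((Fin m ⊕ Fin n) →₀ ℕ) →+ ℕ :=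
  Finsupp.weight (Sum.elim (fun i : Fin m => (i : ℕ)) (fun j : Fin n => (j : ℕ)))

theorem hh_wt (p : Fin m × Fin n) : hh (wt p) = (p.1 : ℕ) + p.2 := by
  simp [hh, wt, Finsupp.weight_single]

/-- the height of a monomial exponent -/
noncomputable def NN (α : (Fin m × Fin n) →₀ ℕ) : ℕ := hh (Finsupp.weight wt α)

theorem NN_add (α β : (Fin m × Fin n) →₀ ℕ) : NN (α + β) = NN α + NN β := by
  simp [NN]

theorem NN_single (p : Fin m × Fin n) : NN (Finsupp.single p 1) = (p.1 : ℕ) + p.2 := by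
  simp [NN, Finsupp.weight_single, hh_wt]

/-- all monomials have height `< k` -/
def Low (k : ℕ) (f : MvPolynomial (Fin m × Fin n) K) : Prop := ∀ β, coeff β f ≠ 0 → NN β < k

theorem Low.add {k : ℕ} {f g : MvPolynomial (Fin m × Fin n) K} (hf : Low k f) (hg : Low k g) :
    Low k (f + g) := by
  intro β hβ
  by_cases h : coeff β f = 0
  · exact hg β (fun h' => hβ (by rw [coeff_add, h, h', add_zero]))
  · exact hf β h

theorem Low.sum {ι : Type*} (s : Finset ι) {k : ℕ} {f : ι → MvPolynomial (Fin m × Fin n) K}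
    (hf : ∀ i ∈ s, Low k (f i)) : Low k (∑ i ∈ s, f i) := by
  classical
  induction s using Finset.induction_on with
  | empty => intro β hβ; simp at hβ
  | insert a s ha ih =>
    rw [Finset.sum_insert ha]
    exact (hf a (by simp)).add (ih fun i hi => hf i (by simp [hi]))

theorem Low.mul {a b : ℕ} {f g : MvPolynomial (Fin m × Fin n) K} (hf : Low (a+1) f) (hg : Low b g) :
    Low (a + b) (f * g) := by
  classical
  intro β hβ
  rw [coeff_mul] at hβ
  obtain ⟨x, hx, hne⟩ := Finset.exists_ne_zero_of_sum_ne_zero hβ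
  have h1 := hf x.1 (left_ne_zero_of_mul hne)
  have h2 := hg x.2 (right_ne_zero_of_mul hne)
  rw [Finset.HasAntidiagonal.mem_antidiagonal] at hx
  rw [← hx, NN_add]
  omega

theorem Low.mono {a b : ℕ} (hab : a ≤ b) {f : MvPolynomial (Fin m × Fin n) K} (hf : Low a f) :
    Low b f := fun β hβ => (hf β hβ).trans_le hab

theorem low_monomial (α : (Fin m × Fin n) →₀ ℕ) (a : K) : Low (NN α + 1) (monomial α a) := by
  classical
  intro β hβ
  rw [coeff_monomial] at hβ
  have : α = β := by by_contra h; simp [h] at hβ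
  rw [this]; omega

/-- lower unitriangular -/
def Lo (g : Matrix (Fin m) (Fin m) K) : Prop := (∀ i, g i i = 1) ∧ ∀ i j, i < j → g i j = 0

/-- upper unitriangular -/
def Up (g : Matrix (Fin m) (Fin m) K) : Prop := (∀ i, g i i = 1) ∧ ∀ i j, j < i → g i j = 0

theorem low_X {g : Matrix (Fin m) (Fin m) K} {h : Matrix (Fin n) (Fin n) K} (hg : Lo g) (hh : Up h)
    (p : Fin m × Fin n) : Low (NN (Finsupp.single p 1)) (gsub g h (X p) - X p) := by
  have : gsub g h (X p) - X p = ∑ q ∈ Finset.univ.erase p, C (g p.1 q.1 * h q.2 p.2) * X q := by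
    rw [gsub_X, ← Finset.add_sum_erase _ _ (Finset.mem_univ p), hg.1, hh.1]
    simp
  rw [this]
  refine Low.sum _ fun q hq => ?_
  have hqp : q ≠ p := (Finset.mem_erase.1 hq).1
  by_cases h1 : p.1 < q.1
  · rw [hg.2 _ _ h1]; intro β hβ; simp at hβ
  by_cases h2 : p.2 < q.2
  · rw [hh.2 _ _ h2]; intro β hβ; simp at hβ
  have h3 : (q.1 : ℕ) + q.2 < (p.1 : ℕ) + p.2 := by
    by_contra h4
    apply hqp
    have h1' : (q.1 : ℕ) ≤ p.1 := by simpa using h1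
    have h2' : (q.2 : ℕ) ≤ p.2 := by simpa using h2
    exact Prod.ext (Fin.ext (by omega)) (Fin.ext (by omega))
  rw [X, C_mul_monomial]
  refine (low_monomial _ _).mono ?_
  rw [NN_single, NN_single]; omega

theorem low_gsub_monomial {g : Matrix (Fin m) (Fin m) K} {h : Matrix (Fin n) (Fin n) K} (hg : Lo g)
    (hh : Up h) (α : (Fin m × Fin n) →₀ ℕ) :
    Low (NN α) (gsub g h (monomial α 1) - monomial α 1) := by
  induction α using Finsupp.induction_linear with
  | zero => intro β hβ; simp at hβ
  | add α β h1 h2 =>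
    have : (monomial (α + β) (1 : K)) = monomial α 1 * monomial β 1 := by
      rw [monomial_mul, mul_one]
    rw [this, map_mul]
    have e : gsub g h (monomial α 1) * gsub g h (monomial β 1) - monomial α 1 * monomial β 1
      = ((gsub g h (monomial α 1) - monomial α 1) + monomial α 1) * (gsub g h (monomial β 1) - monomial β 1)
        + monomial β 1 * (gsub g h (monomial α 1) - monomial α 1) := by ring
    rw [e, NN_add]
    refine Low.add ?_ ?_
    · exact Low.mul ((h1.mono (by omega)).add (low_monomial _ _)) h2
    · rw [add_comm]
      exact Low.mul (low_monomial _ _) h1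
  | single p k =>
    induction k with
    | zero => intro β hβ; simp at hβ
    | succ k ih =>
      have : (monomial (Finsupp.single p (k+1)) (1 : K)) = X p * monomial (Finsupp.single p k) 1 := by
        rw [mul_comm, mono_mul_X, Finsupp.single_add]
      rw [this, map_mul]
      have e : gsub g h (X p) * gsub g h (monomial (Finsupp.single p k) 1) - X p * monomial (Finsupp.single p k) 1
        = ((gsub g h (X p) - X p) + X p) * (gsub g h (monomial (Finsupp.single p k) 1) - monomial (Finsupp.single p k) 1)
        + monomial (Finsupp.single p k) 1 * (gsub g h (X p) - X p) := by ring
      rw [e, add_comm k 1, Finsupp.single_add, NN_add]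
      have hX := low_X hg hh p
      refine Low.add ?_ ?_
      · exact Low.mul ((hX.mono (by omega)).add (low_monomial _ _)) ih
      · rw [add_comm]
        exact Low.mul (low_monomial _ _) hX

/-- a nonzero stable subspace contains a weight vector fixed by unitriangular substitutions -/
theorem exists_hw [Infinite K] (S : Submodule K (MvPolynomial (Fin m × Fin n) K))
    (hS : ∀ g h, ∀ f ∈ S, gsub g h f ∈ S) (hne : ∃ f ∈ S, f ≠ 0) :
    ∃ f ∈ S, f ≠ 0 ∧ (∃ μ, IsWeightedHomogeneous wt f μ) ∧
      ∀ g h, Lo g → Up h → gsub g h f = f := by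
  classical
  have hcomp : ∀ f ∈ S, ∀ μ, weightedHomogeneousComponent wt μ f ∈ S := by
    intro f hf μ
    refine comp_mem wt S ?_ hf μ
    intro τ f hf
    rw [← gsub_diag]
    exact hS _ _ f hf
  have hnz : ∀ f : MvPolynomial (Fin m × Fin n) K, f ≠ 0 → ∃ α, coeff α f ≠ 0 := by
    intro f hf
    by_contra hcon
    push Not at hcon
    exact hf (by ext α; simp [hcon α])
  have hex : ∃ k, ∃ f ∈ S, f ≠ 0 ∧ ∃ μ, IsWeightedHomogeneous wt f μ ∧ hh μ = k := by
    obtain ⟨f, hf, hf0⟩ := hne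
    obtain ⟨α, hα⟩ := hnz f hf0
    refine ⟨_, _, hcomp f hf (Finsupp.weight wt α), ?_, _,
      weightedHomogeneousComponent_isWeightedHomogeneous _ _, rfl⟩
    intro h0
    have := congrArg (coeff α) h0
    rw [coeff_weightedHomogeneousComponent, if_pos rfl] at this
    exact hα this
  obtain ⟨f, hf, hf0, μ, hμ, hk⟩ := Nat.find_spec hex
  refine ⟨f, hf, hf0, ⟨μ, hμ⟩, ?_⟩
  intro g h hg hh'
  by_contra hcon
  obtain ⟨α, hα⟩ := hnz _ (sub_ne_zero.2 hcon)
  have hlow : Low (hh μ) (gsub g h f - f) := by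
    have : gsub g h f - f = ∑ β ∈ f.support, C (coeff β f) * (gsub g h (monomial β 1) - monomial β 1) := by
      conv_lhs => rw [f.as_sum]
      rw [map_sum, ← Finset.sum_sub_distrib]
      refine Finset.sum_congr rfl fun β _ => ?_
      have e : (monomial β (coeff β f) : MvPolynomial (Fin m × Fin n) K) = C (coeff β f) * monomial β 1 := by
        rw [C_mul_monomial, mul_one]
      have e2 : gsub g h (C (coeff β f)) = C (coeff β f) := by simp [gsub, lsub]
      rw [e, map_mul, e2]; ring
    rw [this]
    refine Low.sum _ fun β hβ => ?_
    have h1 := low_gsub_monomial hg hh' β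
    have h2 : NN β = hh μ := by rw [NN, hμ (mem_support_iff.1 hβ)]
    rw [h2] at h1
    intro γ hγ
    rw [coeff_C_mul] at hγ
    exact h1 γ (right_ne_zero_of_mul hγ)
  have h3 := hlow α hα
  have hD : gsub g h f - f ∈ S := S.sub_mem (hS _ _ f hf) hf
  refine Nat.find_min hex (m := NN α) (by rw [← hk]; exact h3) ⟨_, hcomp _ hD (Finsupp.weight wt α), ?_, _,
      weightedHomogeneousComponent_isWeightedHomogeneous _ _, rfl⟩
  intro h0
  have := congrArg (coeff α) h0
  rw [coeff_weightedHomogeneousComponent, if_pos rfl] at this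
  exact hα this
end


/-! ### Leading minors and highest weight vectors -/

section
variable {K : Type*} [Field K] {m n : ℕ}

/-- leading minor, of size `k+1` -/
noncomputable def ld (K : Type*) [Field K] {m n : ℕ} (hmn : m ≤ n) (k : Fin m) :
    MvPolynomial (Fin m × Fin n) K :=
  mnr K (a := (k : ℕ) + 1) (Fin.castLE k.2) (Fin.castLE ((Nat.succ_le_of_lt k.2).trans hmn))

/-- value of the leading minor -/
noncomputable def ldv (hmn : m ≤ n) (M : Matrix (Fin m) (Fin n) K) (k : Fin m) : K :=
  (Matrix.of fun i j : Fin ((k : ℕ) + 1) =>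
    M (Fin.castLE k.2 i) (Fin.castLE ((Nat.succ_le_of_lt k.2).trans hmn) j)).det

theorem eval_ld (hmn : m ≤ n) (M : Matrix (Fin m) (Fin n) K) (k : Fin m) :
    eval (fun p => M p.1 p.2) (ld K hmn k) = ldv hmn M k := by
  unfold ld mnr ldv
  rw [RingHom.map_det]
  congr 1
  ext i j
  simp

theorem ldv_mul_left (hmn : m ≤ n) (M : Matrix (Fin m) (Fin n) K) (k : Fin m)
    {g : Matrix (Fin m) (Fin m) K} (hg : Lo g) : ldv hmn (g * M) k = ldv hmn M k := by
  have h1 : (Matrix.of fun i j : Fin ((k : ℕ) + 1) =>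
      (g * M) (Fin.castLE k.2 i) (Fin.castLE ((Nat.succ_le_of_lt k.2).trans hmn) j))
    = (Matrix.of fun i j : Fin ((k : ℕ) + 1) => g (Fin.castLE k.2 i) (Fin.castLE k.2 j)) *
      (Matrix.of fun i j : Fin ((k : ℕ) + 1) =>
        M (Fin.castLE k.2 i) (Fin.castLE ((Nat.succ_le_of_lt k.2).trans hmn) j)) := by
    ext i j
    simp only [Matrix.of_apply, Matrix.mul_apply]
    symm
    refine Fintype.sum_of_injective (Fin.castLE k.2) (Fin.castLE_injective _) _ _ ?_ (fun _ => rfl)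
    intro l hl
    rw [hg.2, zero_mul]
    by_contra hcon
    apply hl
    have h2 : (l : ℕ) ≤ i := by simpa [Fin.lt_def] using hcon
    exact ⟨⟨l, by omega⟩, by ext; simp⟩
  unfold ldv
  rw [h1, Matrix.det_mul, Matrix.det_of_isLowerTriangular]
  · simp [hg.1]
  · intro i j hij
    have h2 : (i : ℕ) < j := hij
    exact hg.2 _ _ h2

theorem ldv_mul_right (hmn : m ≤ n) (M : Matrix (Fin m) (Fin n) K) (k : Fin m)
    {g : Matrix (Fin n) (Fin n) K} (hg : Up g) : ldv hmn (M * g) k = ldv hmn M k := by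
  have hk : (k : ℕ) + 1 ≤ n := (Nat.succ_le_of_lt k.2).trans hmn
  have h1 : (Matrix.of fun i j : Fin ((k : ℕ) + 1) =>
      (M * g) (Fin.castLE k.2 i) (Fin.castLE hk j))
    = (Matrix.of fun i j : Fin ((k : ℕ) + 1) =>
        M (Fin.castLE k.2 i) (Fin.castLE hk j)) *
      (Matrix.of fun i j : Fin ((k : ℕ) + 1) => g (Fin.castLE hk i) (Fin.castLE hk j)) := by
    ext i j
    simp only [Matrix.of_apply, Matrix.mul_apply]
    symm
    refine Fintype.sum_of_injective (Fin.castLE hk) (Fin.castLE_injective _) _ _ ?_ (fun _ => rfl)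
    intro l hl
    rw [hg.2, mul_zero]
    by_contra hcon
    apply hl
    have h2 : (l : ℕ) ≤ j := by simpa [Fin.lt_def] using hcon
    exact ⟨⟨l, by omega⟩, by ext; simp⟩
  unfold ldv
  rw [h1, Matrix.det_mul, Matrix.det_of_isUpperTriangular (M := Matrix.of fun i j : Fin ((k : ℕ) + 1) => g (Fin.castLE hk i) (Fin.castLE hk j))]
  · simp [hg.1]
  · intro i j hij
    have h2 : (j : ℕ) < i := hij
    exact hg.2 _ _ h2

theorem ldv_diag (hmn : m ≤ n) (M : Matrix (Fin m) (Fin n) K) (k : Fin m)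
    (hM : ∀ (i : Fin m) (j : Fin n), (i : ℕ) ≤ k → (j : ℕ) ≤ k → (i : ℕ) ≠ j → M i j = 0) :
    ldv hmn M k = ∏ i : Fin ((k : ℕ) + 1), M (Fin.castLE k.2 i) (Fin.castLE ((Nat.succ_le_of_lt k.2).trans hmn) i) := by
  unfold ldv
  rw [Matrix.det_of_isUpperTriangular]
  · rfl
  · intro i j hij
    have h1 : (j : ℕ) < i := hij
    have := i.2
    have := j.2
    exact hM _ _ (Nat.lt_succ_iff.1 i.2) (Nat.lt_succ_iff.1 j.2) (Nat.ne_of_gt h1)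

theorem Lo.mul {g h : Matrix (Fin m) (Fin m) K} (hg : Lo g) (hh : Lo h) : Lo (g * h) := by
  constructor
  · intro i
    rw [Matrix.mul_apply, Finset.sum_eq_single i, hg.1, hh.1, one_mul]
    · intro l _ hl
      rcases lt_or_gt_of_ne hl with h1 | h1
      · rw [hh.2 _ _ h1, mul_zero]
      · rw [hg.2 _ _ h1, zero_mul]
    · simp
  · intro i j hij
    rw [Matrix.mul_apply]
    refine Finset.sum_eq_zero fun l _ => ?_
    rcases lt_or_ge i l with h1 | h1
    · rw [hg.2 _ _ h1, zero_mul]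
    · rw [hh.2 _ _ (h1.trans_lt hij), mul_zero]

theorem Up.mul {g h : Matrix (Fin m) (Fin m) K} (hg : Up g) (hh : Up h) : Up (g * h) := by
  constructor
  · intro i
    rw [Matrix.mul_apply, Finset.sum_eq_single i, hg.1, hh.1, one_mul]
    · intro l _ hl
      rcases lt_or_gt_of_ne hl with h1 | h1
      · rw [hg.2 _ _ h1, zero_mul]
      · rw [hh.2 _ _ h1, mul_zero]
    · simp
  · intro i j hij
    rw [Matrix.mul_apply]
    refine Finset.sum_eq_zero fun l _ => ?_
    rcases lt_or_ge l i with h1 | h1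
    · rw [hg.2 _ _ h1, zero_mul]
    · rw [hh.2 _ _ (hij.trans_le h1), mul_zero]

theorem Lo.one : Lo (1 : Matrix (Fin m) (Fin m) K) :=
  ⟨fun i => Matrix.one_apply_eq i, fun _ _ h => Matrix.one_apply_ne h.ne⟩

theorem Up.one : Up (1 : Matrix (Fin m) (Fin m) K) :=
  ⟨fun i => Matrix.one_apply_eq i, fun _ _ h => Matrix.one_apply_ne h.ne'⟩

theorem exists_ldu (hmn : m ≤ n) (M : Matrix (Fin m) (Fin n) K) (hM : ∀ k, ldv hmn M k ≠ 0) (k : ℕ)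
    (hk : k ≤ m) : ∃ (g : Matrix (Fin m) (Fin m) K) (h : Matrix (Fin n) (Fin n) K), Lo g ∧ Up h ∧ ∀ (i : Fin m) (j : Fin n), (i : ℕ) ≠ j →
      ((i : ℕ) < k ∨ (j : ℕ) < k) → (g * M * h) i j = 0 := by
  induction k with
  | zero => exact ⟨1, 1, Lo.one, Up.one, fun i j _ h => by omega⟩
  | succ k ih =>
    obtain ⟨g, h, hg, hh, hz⟩ := ih (by omega)
    set N := g * M * h with hN
    set a : Fin m := ⟨k, hk⟩ with ha
    set b : Fin n := ⟨k, by omega⟩ with hb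
    have hNk : N a b ≠ 0 := by
      have h1 : ldv hmn N a ≠ 0 := by
        rw [hN, ldv_mul_right _ _ _ hh, ldv_mul_left _ _ _ hg]; exact hM a
      rw [ldv_diag _ _ _ (fun i j hi hj hij => hz i j hij (by simp [ha] at hi hj; omega))] at h1
      have h2 := Finset.prod_ne_zero_iff.1 h1 ⟨k, by simp [ha]⟩ (Finset.mem_univ _)
      exact h2
    let u : Fin m → K := fun i => if k < (i : ℕ) then - N i b / N a b else 0
    let v : Fin n → K := fun j => if k < (j : ℕ) then - N a j / N a b else 0
    let g' : Matrix (Fin m) (Fin m) K := Matrix.of fun i l => (if i = l then 1 else 0) + (if l = a then u i else 0)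
    let h' : Matrix (Fin n) (Fin n) K := Matrix.of fun l j => (if l = j then 1 else 0) + (if l = b then v j else 0)
    have hg' : Lo g' := by
      constructor
      · intro i
        by_cases hi : i = a
        · simp [g', u, hi, ha]
        · simp [g', hi]
      · intro i j hij
        by_cases hj : j = a
        · subst hj
          have h1 : (i : ℕ) < k := hij
          simp [g', u, hij.ne, h1.le]
        · simp [g', hj, hij.ne]
    have hh' : Up h' := by
      constructor
      · intro i
        by_cases hi : i = b
        · simp [h', v, hi, hb]
        · simp [h', hi]
      · intro i j hij
        by_cases hi : i = b
        · subst hi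
          have h1 : (j : ℕ) < k := hij
          simp [h', v, hij.ne', h1.le]
        · simp [h', hi, hij.ne']
    refine ⟨g' * g, h * h', hg'.mul hg, hh.mul hh', ?_⟩
    have e : (g' * g) * M * (h * h') = g' * N * h' := by
      rw [hN]; simp only [Matrix.mul_assoc]
    rw [e]
    have e2 : ∀ i j, (g' * N * h') i j = (N i j + u i * N a j) + (N i b + u i * N a b) * v j := by
      have e1 : ∀ i j, (g' * N) i j = N i j + u i * N a j := by
        intro i j
        simp [g', Matrix.mul_apply, add_mul, Finset.sum_add_distrib]
      intro i j
      rw [Matrix.mul_apply]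
      simp only [e1]
      simp [h', mul_add, Finset.sum_add_distrib]
    intro i j hij hlt
    rw [e2]
    by_cases hj : (j : ℕ) < k
    · rw [hz i j hij (Or.inr hj), hz a j (by simp [ha]; omega) (Or.inr hj)]
      simp [v, hj.le]
    by_cases hi : (i : ℕ) < k
    · rw [hz i j hij (Or.inl hi), hz i b (by simp [hb]; omega) (Or.inl hi)]
      have : u i = 0 := if_neg (by omega)
      simp [this]
    rcases (show (i : ℕ) = k ∨ (j : ℕ) = k by omega) with h1 | h1
    · have hia : i = a := Fin.ext h1
      subst hia
      have h2 : k < (j : ℕ) := by omega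
      have : u a = 0 := by simp [u, ha]
      rw [this]
      simp only [v, if_pos h2]
      field_simp
      ring
    · have hjb : j = b := Fin.ext h1
      subst hjb
      have h2 : k < (i : ℕ) := by omega
      have : v b = 0 := by simp [v, hb]
      rw [this]
      simp only [u, if_pos h2]
      field_simp
      ring

theorem tele (d : ℕ → K) (ν : ℕ → ℕ) (M : ℕ) :
    (∏ k ∈ Finset.range M, d k ^ ν k) * ∏ k ∈ Finset.range M, (∏ i ∈ Finset.range (k+1), d i) ^ (ν (k+1) - ν k)
    = (∏ k ∈ Finset.range M, (∏ i ∈ Finset.range (k+1), d i) ^ (ν k - ν (k+1))) * (∏ i ∈ Finset.range M, d i) ^ ν M := by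
  induction M with
  | zero => simp
  | succ M ih =>
    rw [Finset.prod_range_succ, Finset.prod_range_succ (fun k => (∏ i ∈ Finset.range (k+1), d i) ^ (ν (k+1) - ν k)),
      Finset.prod_range_succ (fun k => (∏ i ∈ Finset.range (k+1), d i) ^ (ν k - ν (k+1)))]
    set P := ∏ k ∈ Finset.range M, d k ^ ν k
    set A := ∏ k ∈ Finset.range M, (∏ i ∈ Finset.range (k+1), d i) ^ (ν (k+1) - ν k)
    set B := ∏ k ∈ Finset.range M, (∏ i ∈ Finset.range (k+1), d i) ^ (ν k - ν (k+1))
    have hQ : ∏ i ∈ Finset.range (M+1), d i = (∏ i ∈ Finset.range M, d i) * d M := Finset.prod_range_succ _ _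
    set Q := ∏ i ∈ Finset.range M, d i
    set Q' := ∏ i ∈ Finset.range (M+1), d i
    calc P * d M ^ ν M * (A * Q' ^ (ν (M+1) - ν M)) = (P * A) * d M ^ ν M * Q' ^ (ν (M+1) - ν M) := by ring
      _ = B * (Q' ^ ν M * Q' ^ (ν (M+1) - ν M)) := by rw [ih, hQ, mul_pow]; ring
      _ = B * (Q' ^ (ν M - ν (M+1)) * Q' ^ ν (M+1)) := by
        rw [← pow_add, ← pow_add]; congr 2; omega
      _ = _ := by ring

/-- identity matrix (rectangular) -/
def EE (K : Type*) [Field K] (m n : ℕ) : Matrix (Fin m) (Fin n) K :=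
  Matrix.of fun i j => if (i : ℕ) = j then 1 else 0

theorem ldv_EE (hmn : m ≤ n) (k : Fin m) : ldv hmn (EE K m n) k = 1 := by
  rw [ldv_diag]
  · simp [EE]
  · intro i j _ _ hij
    simp [EE, hij]

theorem eval_EE_prod (hmn : m ≤ n) (e : Fin m → ℕ) :
    eval (fun p => EE K m n p.1 p.2) (∏ k, ld K hmn k ^ e k) = 1 := by
  simp [map_prod, eval_ld, ldv_EE]

theorem prod_ld_ne (hmn : m ≤ n) (e : Fin m → ℕ) : ∏ k, ld K hmn k ^ e k ≠ 0 := by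
  intro h
  have := eval_EE_prod (K := K) hmn e
  rw [h] at this
  simp at this

/-- permutation-like matrix -/
def WW (K : Type*) [Field K] (m n i : ℕ) : Matrix (Fin m) (Fin n) K :=
  Matrix.of fun p q => if Equiv.swap i (i+1) (p : ℕ) = q then 1 else 0

theorem ldv_WW_self (hmn : m ≤ n) (i : Fin m) : ldv hmn (WW K m n i) i = 0 := by
  unfold ldv
  apply Matrix.det_eq_zero_of_row_eq_zero (Fin.last _)
  intro j
  have := j.2
  simp only [WW, Matrix.of_apply, Fin.val_castLE, Fin.val_last, Equiv.swap_apply_left]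
  rw [if_neg]; omega

theorem ldv_WW_ne (hmn : m ≤ n) (i : ℕ) (k : Fin m) (hk : (k : ℕ) ≠ i) : ldv hmn (WW K m n i) k ≠ 0 := by
  unfold ldv
  set A := (Matrix.of fun a b : Fin ((k : ℕ) + 1) =>
    WW K m n i (Fin.castLE k.2 a) (Fin.castLE ((Nat.succ_le_of_lt k.2).trans hmn) b)) with hA
  have hs : ∀ p : Fin ((k : ℕ) + 1), Equiv.swap i (i+1) (p : ℕ) < k + 1 := by
    intro p
    have := p.2
    rw [Equiv.swap_apply_def]
    split_ifs <;> omega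
  have hAA : A * A = 1 := by
    ext p r
    rw [Matrix.mul_apply, Finset.sum_eq_single ⟨_, hs p⟩]
    · simp [hA, WW, Matrix.one_apply, Fin.ext_iff]
    · intro b _ hb
      have : ¬ (Equiv.swap i (i+1) (p : ℕ) = b) := fun h => hb (Fin.ext h.symm)
      simp [hA, WW, this]
    · simp
  intro h0
  have := congrArg Matrix.det hAA
  rw [Matrix.det_mul, h0] at this
  simp at this

theorem hw_eval (hmn : m ≤ n) {f : MvPolynomial (Fin m × Fin n) K} {μ : (Fin m ⊕ Fin n) →₀ ℕ}
    (hμ : IsWeightedHomogeneous wt f μ) (hfix : ∀ g h, Lo g → Up h → gsub g h f = f)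
    (ν : ℕ → ℕ) (hν : ∀ i : Fin m, ν i = μ (Sum.inl i)) (hνm : ν m = 0)
    (M : Matrix (Fin m) (Fin n) K) (hM : ∀ k, ldv hmn M k ≠ 0) :
    eval (fun p => M p.1 p.2) f * ∏ k : Fin m, ldv hmn M k ^ (ν (k+1) - ν k)
      = eval (fun p => EE K m n p.1 p.2) f * ∏ k : Fin m, ldv hmn M k ^ (ν k - ν (k+1)) := by
  obtain ⟨g, h, hg, hh, hz⟩ := exists_ldu hmn M hM m le_rfl
  set D := g * M * h with hD
  have hfD : eval (fun p => M p.1 p.2) f = eval (fun p => D p.1 p.2) f := by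
    rw [hD, ← eval_gsub, hfix g h hg hh]
  have hzD : ∀ (i : Fin m) (j : Fin n), (i : ℕ) ≠ j → D i j = 0 := fun i j hij => hz i j hij (Or.inl i.2)
  let d : ℕ → K := fun i => if hi : i < m then D ⟨i, hi⟩ ⟨i, hi.trans_le hmn⟩ else 1
  have hdd : ∀ i : Fin m, d i = D i (Fin.castLE hmn i) := by
    intro i; simp [d]; rfl
  have hldv : ∀ k : Fin m, ldv hmn M k = ∏ i ∈ Finset.range (k+1), d i := by
    intro k
    rw [← ldv_mul_left hmn M k hg, ← ldv_mul_right hmn _ k hh, ← hD,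
      ldv_diag _ _ _ (fun i j _ _ h => hzD i j h), Finset.prod_range]
    refine Finset.prod_congr rfl fun i _ => ?_
    have h1 := hdd (Fin.castLE k.2 i)
    exact h1.symm
  have hDE : D = Matrix.diagonal (fun i : Fin m => d i) * EE K m n * Matrix.diagonal (fun _ : Fin n => (1 : K)) := by
    ext i j
    rw [Matrix.mul_diagonal, Matrix.diagonal_mul, mul_one]
    by_cases hij : (i : ℕ) = j
    · have : j = Fin.castLE hmn i := Fin.ext hij.symm
      simp [EE, this, hdd]
    · simp [EE, hij, hzD i j hij]
  have hfE : eval (fun p => M p.1 p.2) f = (∏ i ∈ Finset.range m, d i ^ ν i) * eval (fun p => EE K m n p.1 p.2) f := by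
    have h1 := gsub_diag (m := m) (n := n) (Sum.elim (fun i : Fin m => d i) (fun _ : Fin n => (1 : K)))
    simp only [Sum.elim_inl, Sum.elim_inr] at h1
    rw [hfD, hDE, ← eval_gsub, h1, tsub_homog _ _ hμ, map_mul, eval_C, eval_monomial, one_mul,
      Finsupp.prod_fintype _ _ (fun i => pow_zero _), Fintype.prod_sum_type, Finset.prod_range]
    simp [hν]
  rw [hfE]
  simp_rw [hldv]
  rw [← Finset.prod_range (fun k => (∏ i ∈ Finset.range (k+1), d i) ^ (ν (k+1) - ν k)),
    ← Finset.prod_range (fun k => (∏ i ∈ Finset.range (k+1), d i) ^ (ν k - ν (k+1)))]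
  have := tele d ν m
  rw [hνm, pow_zero, mul_one] at this
  rw [mul_right_comm, this, mul_comm]

theorem exists_prod_ld [Infinite K] (hmn : m ≤ n) (S : Submodule K (MvPolynomial (Fin m × Fin n) K))
    (hS : ∀ g h, ∀ f ∈ S, gsub g h f ∈ S) (hne : ∃ f ∈ S, f ≠ 0) :
    ∃ e : Fin m → ℕ, ∏ k, ld K hmn k ^ e k ∈ S := by
  obtain ⟨f, hf, hf0, ⟨μ, hμ⟩, hfix⟩ := exists_hw S hS hne
  let ν : ℕ → ℕ := fun i => if hi : i < m then μ (Sum.inl ⟨i, hi⟩) else 0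
  have hν : ∀ i : Fin m, ν i = μ (Sum.inl i) := fun i => by simp [ν]
  have hνm : ν m = 0 := by simp [ν]
  have key := hw_eval hmn hμ hfix ν hν hνm
  set c := eval (fun p => EE K m n p.1 p.2) f with hc
  have hid : f * ∏ k : Fin m, ld K hmn k ^ (ν (k+1) - ν k) = C c * ∏ k : Fin m, ld K hmn k ^ (ν k - ν (k+1)) := by
    have h1 : (∏ k : Fin m, ld K hmn k ^ 1) ≠ 0 := prod_ld_ne hmn (fun _ => 1)
    refine mul_right_cancel₀ h1 ?_
    apply MvPolynomial.funext
    intro x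
    obtain ⟨M, rfl⟩ : ∃ M : Matrix (Fin m) (Fin n) K, x = fun p => M p.1 p.2 :=
      ⟨Matrix.of fun i j => x (i, j), rfl⟩
    by_cases hM : ∀ k, ldv hmn M k ≠ 0
    · have := key M hM
      simp only [map_mul, map_prod, map_pow, eval_ld, eval_C]
      rw [this]
    · push Not at hM
      obtain ⟨k, hk⟩ := hM
      have : eval (fun p => M p.1 p.2) (∏ k : Fin m, ld K hmn k ^ 1) = 0 := by
        simp only [map_prod, pow_one, eval_ld]
        exact Finset.prod_eq_zero (Finset.mem_univ k) hk
      simp only [map_mul, this, mul_zero]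
  have hc0 : c ≠ 0 := by
    intro h
    rw [h, C_0, zero_mul] at hid
    rcases mul_eq_zero.1 hid with h1 | h1
    · exact hf0 h1
    · exact prod_ld_ne hmn (fun k : Fin m => ν (k+1) - ν k) h1
  have hb : ∀ k : Fin m, ν (k+1) - ν k = 0 := by
    intro i
    by_contra hi
    have h1 := congrArg (eval fun p => WW K m n i p.1 p.2) hid
    simp only [map_mul, map_prod, map_pow, eval_ld, eval_C] at h1
    rw [Finset.prod_eq_zero (Finset.mem_univ i) (by rw [ldv_WW_self, zero_pow hi]), mul_zero] at h1
    refine mul_ne_zero hc0 ?_ h1.symm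
    refine Finset.prod_ne_zero_iff.2 fun k _ => ?_
    by_cases hk : k = i
    · subst hk
      rw [show ν k - ν (k+1) = 0 by omega, pow_zero]
      exact one_ne_zero
    · exact pow_ne_zero _ (ldv_WW_ne hmn i k (fun h => hk (Fin.ext h)))
  refine ⟨fun k => ν k - ν (k+1), ?_⟩
  have : ∏ k : Fin m, ld K hmn k ^ (ν k - ν (k+1)) = c⁻¹ • f := by
    simp only [hb, pow_zero, Finset.prod_const_one, mul_one] at hid
    rw [hid, ← smul_eq_C_mul, smul_smul, inv_mul_cancel₀ hc0, one_smul]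
  rw [this]
  exact S.smul_mem _ hf
end


/-! ### Main comparison lemma -/

theorem totalDegree_lsub {σ K : Type*} [Fintype σ] [Field K] (A : σ → σ → K) (f : MvPolynomial σ K) :
    (lsub A f).totalDegree ≤ f.totalDegree := by
  conv_lhs => rw [f.as_sum, map_sum]
  refine totalDegree_finsetSum_le fun α hα => ?_
  have h1 : (α.sum fun _ e => e) ≤ f.totalDegree := le_totalDegree hα
  rw [lsub, aeval_monomial]
  refine (totalDegree_mul _ _).trans ?_
  rw [algebraMap_eq, totalDegree_C, zero_add]
  refine (totalDegree_finsetProd _ _).trans (le_trans ?_ h1)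
  refine Finset.sum_le_sum fun i _ => ?_
  refine (totalDegree_pow _ _).trans ?_
  have h2 : (∑ q, C (A i q) * X q : MvPolynomial σ K).totalDegree ≤ 1 := by
    refine totalDegree_finsetSum_le fun q _ => ?_
    refine (totalDegree_mul _ _).trans ?_
    rw [totalDegree_C, totalDegree_X]
  nlinarith

theorem main_lemma {m n : ℕ} (hmn : m ≤ n) (J B : Submodule ℚ (MvPolynomial (Fin m × Fin n) ℚ))
    (hJ : ∀ g h, ∀ f ∈ J, gsub g h f ∈ J) (hB : ∀ g h, ∀ f ∈ B, gsub g h f ∈ B)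
    (hJB : ∀ e : Fin m → ℕ, ∏ k, ld ℚ hmn k ^ e k ∈ J → ∏ k, ld ℚ hmn k ^ e k ∈ B) : J ≤ B := by
  classical
  intro f hf
  by_contra hfB
  let P := restrictTotalDegree (Fin m × Fin n) ℚ f.totalDegree
  have hP : ∀ g h, ∀ f ∈ P, gsub g h f ∈ P := by
    intro g h f hf
    rw [mem_restrictTotalDegree] at hf ⊢
    exact (totalDegree_lsub _ _).trans hf
  have : FiniteDimensional ℚ (J ⊓ P : Submodule ℚ _) :=
    Submodule.finiteDimensional_of_le (inf_le_right : J ⊓ P ≤ P)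
  have hfP : f ∈ P := by rw [mem_restrictTotalDegree]
  obtain ⟨f', hf', hf0, hort⟩ := exists_orth (J ⊓ P) (B ⊓ (J ⊓ P)) inf_le_right
    (fun h => hfB (h ⟨hf, hfP⟩).1)
  let S : Submodule ℚ (MvPolynomial (Fin m × Fin n) ℚ) :=
    (J ⊓ P) ⊓ ⨅ b : (B ⊓ (J ⊓ P) : Submodule ℚ _), LinearMap.ker (ip (b : MvPolynomial (Fin m × Fin n) ℚ))
  have hmem : ∀ f, f ∈ S ↔ (f ∈ J ∧ f ∈ P) ∧ ∀ b, b ∈ B → b ∈ J → b ∈ P → ip b f = 0 := by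
    intro f
    simp only [S, Submodule.mem_inf, Submodule.mem_iInf, LinearMap.mem_ker, Subtype.forall]
    constructor
    · exact fun h => ⟨h.1, fun b h1 h2 h3 => h.2 b ⟨h1, h2, h3⟩⟩
    · exact fun h => ⟨h.1, fun b h1 => h.2 b h1.1 h1.2.1 h1.2.2⟩
  obtain ⟨e, he⟩ := exists_prod_ld hmn S (by
    intro g h f hf
    rw [hmem] at hf ⊢
    refine ⟨⟨hJ _ _ _ hf.1.1, hP _ _ _ hf.1.2⟩, fun b h1 h2 h3 => ?_⟩
    rw [ip_symm]
    have e1 := ip_lsub (fun p q : Fin m × Fin n => g p.1 q.1 * h q.2 p.2) f b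
    have e2 : lsub (fun p q : Fin m × Fin n => g q.1 p.1 * h p.2 q.2) b = gsub g.transpose h.transpose b := rfl
    rw [e2, ip_symm f] at e1
    exact e1.trans (hf.2 _ (hB _ _ _ h1) (hJ _ _ _ h2) (hP _ _ _ h3)))
    ⟨f', (hmem f').2 ⟨hf', fun b h1 h2 h3 => hort b ⟨h1, h2, h3⟩⟩, hf0⟩
  rw [hmem] at he
  exact prod_ld_ne hmn e (ip_self (he.2 _ (hJB e he.1.1) he.1.1 he.1.2))


/-! ### The determinantal valuation -/

section
variable {K : Type*} [Field K] {m n : ℕ}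

/-- coefficient ring -/
abbrev AA (K : Type*) [Field K] (m n : ℕ) := MvPolynomial ((Fin m × Fin m) ⊕ (Fin m × Fin n)) K

/-- diagonal entries -/
noncomputable def dz (A : Type*) [CommRing A] (t k : ℕ) : Polynomial A :=
  if k + 1 < t then 1 else Polynomial.X

/-- generic degeneration -/
noncomputable def Psi (K : Type*) [Field K] (m n t : ℕ) :
    MvPolynomial (Fin m × Fin n) K →ₐ[K] Polynomial (AA K m n) :=
  aeval fun p => ∑ k : Fin m, Polynomial.C (X (Sum.inl (p.1, k))) * dz (AA K m n) t k *
    Polynomial.C (X (Sum.inr (k, p.2)))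

theorem Psi_X (t : ℕ) (p : Fin m × Fin n) : Psi K m n t (X p) =
    ∑ k : Fin m, Polynomial.C (X (Sum.inl (p.1, k))) * dz (AA K m n) t k *
    Polynomial.C (X (Sum.inr (k, p.2))) := by simp [Psi]

/-- valuation ideals -/
noncomputable def VV (K : Type*) [Field K] (m n t s : ℕ) : Ideal (MvPolynomial (Fin m × Fin n) K) :=
  Ideal.comap (Psi K m n t) (Ideal.span {Polynomial.X ^ s})

theorem mem_VV (t s : ℕ) (f : MvPolynomial (Fin m × Fin n) K) :
    f ∈ VV K m n t s ↔ Polynomial.X ^ s ∣ Psi K m n t f := by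
  rw [VV, Ideal.mem_comap, Ideal.mem_span_singleton]

theorem det_mul_mem {R : Type*} [CommRing R] {t : ℕ} (P : Matrix (Fin t) (Fin m) R)
    (N : Matrix (Fin m) (Fin t) R) (J : Ideal R)
    (h : ∀ k : Fin t → Fin m, (Matrix.of fun i j => N (k i) j).det ∈ J) : (P * N).det ∈ J := by
  have e : (P * N).det = Matrix.detRowAlternating (fun i => ∑ k, P i k • N k) := by
    show Matrix.detRowAlternating (P * N) = _
    refine congrArg _ ?_
    ext i j
    simp [Matrix.mul_apply, Finset.sum_apply]
  have e2 := MultilinearMap.map_sum (Matrix.detRowAlternating (R := R) (n := Fin t)).toMultilinearMap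
    (fun (i : Fin t) (k : Fin m) => P i k • N k)
  have e3 : (P * N).det = ∑ r : Fin t → Fin m,
      (Matrix.detRowAlternating (R := R) (n := Fin t)).toMultilinearMap (fun i => P i (r i) • N (r i)) :=
    e.trans e2
  rw [e3]
  refine Ideal.sum_mem _ fun r _ => ?_
  rw [MultilinearMap.map_smul_univ]
  exact Ideal.mul_mem_left _ _ (h r)

theorem map_gsub_minors (t : ℕ) (g : Matrix (Fin m) (Fin m) K) (h : Matrix (Fin n) (Fin n) K) :
    (genericMinors K m n t).map (gsub g h) ≤ genericMinors K m n t := by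
  rw [Ideal.map_le_iff_le_comap]
  refine minors_le fun A D => ?_
  rw [Ideal.mem_comap]
  let P : Matrix (Fin t) (Fin m) (MvPolynomial (Fin m × Fin n) K) := Matrix.of fun i k => C (g (A i) k)
  let M : Matrix (Fin m) (Fin n) (MvPolynomial (Fin m × Fin n) K) := Matrix.of fun i k => X (i, k)
  let Q : Matrix (Fin n) (Fin t) (MvPolynomial (Fin m × Fin n) K) := Matrix.of fun i k => C (h i (D k))
  have e : gsub g h (mnr K A D) = (P * (M * Q)).det := by
    rw [mnr, AlgHom.map_det]
    congr 1
    ext1 i j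
    simp only [AlgHom.mapMatrix_apply, Matrix.map_apply, Matrix.of_apply]
    rw [gsub_X, Fintype.sum_prod_type]
    simp only [P, M, Q, Matrix.mul_apply, Matrix.of_apply, Finset.mul_sum]
    refine Finset.sum_congr rfl fun a _ => Finset.sum_congr rfl fun b _ => ?_
    rw [C_mul]; ring
  rw [e]
  refine det_mul_mem _ _ _ fun k => ?_
  have e2 : (Matrix.of fun i j => (M * Q) (k i) j) = (Q.transpose * (Matrix.of fun i j => M (k j) i)).transpose := by
    ext1 i j
    simp only [Matrix.of_apply, Matrix.transpose_apply, Matrix.mul_apply]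
    exact Finset.sum_congr rfl fun _ _ => mul_comm _ _
  rw [e2, Matrix.det_transpose]
  refine det_mul_mem _ _ _ fun l => ?_
  rw [← Matrix.det_transpose]
  exact mnr_mem k l

theorem map_gsub_mm (g : Matrix (Fin m) (Fin m) K) (h : Matrix (Fin n) (Fin n) K) :
    (mm K m n).map (gsub g h) ≤ mm K m n := by
  rw [Ideal.map_le_iff_le_comap, Ideal.span_le]
  rintro _ ⟨p, rfl⟩
  show gsub g h (X p) ∈ mm K m n
  rw [gsub_X]
  exact Ideal.sum_mem _ fun q _ => Ideal.mul_mem_left _ _ (Ideal.subset_span ⟨q, rfl⟩)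

theorem minors_le_VV {t : ℕ} (ht : 1 ≤ t) (htm : t ≤ m) : genericMinors K m n t ≤ VV K m n t 1 := by
  refine minors_le fun A D => ?_
  rw [mem_VV, pow_one, Polynomial.X_dvd_iff, ← Polynomial.constantCoeff_apply, mnr, AlgHom.map_det,
    RingHom.map_det]
  have e : (Polynomial.constantCoeff (R := AA K m n)).mapMatrix ((Psi K m n t).mapMatrix
      (Matrix.of fun i j => X (A i, D j))) =
      (Matrix.of fun (i k : Fin t) => if (k : ℕ) + 1 < t then (X (Sum.inl (A i, Fin.castLE htm k)) : AA K m n) else 0) *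
      (Matrix.of fun (k j : Fin t) => (X (Sum.inr (Fin.castLE htm k, D j)) : AA K m n)) := by
    ext1 i j
    simp only [AlgHom.mapMatrix_apply, RingHom.mapMatrix_apply, Matrix.map_apply, Matrix.of_apply,
      Matrix.mul_apply, Psi_X, map_sum, map_mul, Polynomial.constantCoeff_apply, Polynomial.coeff_C_zero]
    symm
    refine Fintype.sum_of_injective (Fin.castLE htm) (Fin.castLE_injective _) _ _ ?_ ?_
    · intro l hl
      have : t ≤ l := by
        by_contra hcon
        exact hl ⟨⟨l, by omega⟩, by ext; simp⟩
      rw [dz, if_neg (by omega)]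
      simp
    · intro l
      simp only [dz, Fin.val_castLE]
      split_ifs <;> simp
  rw [e, Matrix.det_mul, Matrix.det_eq_zero_of_column_eq_zero ⟨t - 1, by omega⟩, zero_mul]
  intro i
  simp only [Matrix.of_apply]
  rw [if_neg (by omega)]

theorem VV_gsub (t s : ℕ) (g : Matrix (Fin m) (Fin m) K) (h : Matrix (Fin n) (Fin n) K)
    (f : MvPolynomial (Fin m × Fin n) K) (hf : f ∈ VV K m n t s) : gsub g h f ∈ VV K m n t s := by
  rw [mem_VV] at hf ⊢
  let σ : AA K m n →ₐ[K] AA K m n := aeval (Sum.elim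
    (fun p => ∑ l : Fin m, C (g p.1 l) * X (Sum.inl (l, p.2)))
    (fun p => ∑ l : Fin n, C (h l p.2) * X (Sum.inr (p.1, l))))
  have hσ1 : ∀ p, σ (X (Sum.inl p)) = ∑ l : Fin m, C (g p.1 l) * X (Sum.inl (l, p.2)) := by
    intro p; simp only [σ, aeval_X, Sum.elim_inl]
  have hσ2 : ∀ p, σ (X (Sum.inr p)) = ∑ l : Fin n, C (h l p.2) * X (Sum.inr (p.1, l)) := by
    intro p; simp only [σ, aeval_X, Sum.elim_inr]
  have hσd : ∀ k, Polynomial.mapAlgHom σ (dz _ t k) = dz _ t k := by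
    intro k; unfold dz; split_ifs <;> simp
  have hσC : ∀ a, Polynomial.mapAlgHom σ (Polynomial.C a) = Polynomial.C (σ a) := by
    intro a; simp
  have e : (Psi K m n t).comp (gsub g h) = (Polynomial.mapAlgHom σ).comp (Psi K m n t) := by
    apply MvPolynomial.algHom_ext
    intro p
    have hC : ∀ a : K, Psi K m n t (C a) = Polynomial.C (C a) := fun a => by
      rw [← algebraMap_eq, AlgHom.commutes]; rfl
    simp only [AlgHom.comp_apply]
    rw [gsub_X, Psi_X]
    simp only [map_sum, map_mul, Psi_X, hσd, hσC, hσ1, hσ2, hC, Finset.sum_mul, Finset.mul_sum, Fintype.sum_prod_type]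
    rw [Finset.sum_congr rfl fun a _ => Finset.sum_comm, Finset.sum_comm]
    refine Finset.sum_congr rfl fun k _ => ?_
    rw [Finset.sum_comm]
    refine Finset.sum_congr rfl fun a _ => Finset.sum_congr rfl fun b _ => ?_
    ring
  have e2 := DFunLike.congr_fun e f
  simp only [AlgHom.comp_apply] at e2
  rw [e2]
  obtain ⟨q, hq⟩ := hf
  rw [hq, map_mul, map_pow]
  have hX : Polynomial.mapAlgHom σ Polynomial.X = Polynomial.X := by simp
  rw [hX]
  exact Dvd.intro _ rfl

theorem VV_prime (t : ℕ) : (VV K m n t 1).IsPrime := by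
  have : (Ideal.span {(Polynomial.X : Polynomial (AA K m n)) ^ 1}).IsPrime := by
    rw [pow_one, Ideal.span_singleton_prime Polynomial.X_ne_zero]
    exact Polynomial.prime_X
  exact Ideal.IsPrime.comap _

theorem VV_cancel (t s : ℕ) {u f : MvPolynomial (Fin m × Fin n) K} (hu : u ∉ VV K m n t 1)
    (huf : u * f ∈ VV K m n t s) : f ∈ VV K m n t s := by
  rw [mem_VV] at *
  rw [pow_one] at hu
  rw [map_mul] at huf
  exact Polynomial.prime_X.pow_dvd_of_dvd_mul_left _ hu huf

theorem VV_pow (t s : ℕ) : VV K m n t 1 ^ s ≤ VV K m n t s := by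
  refine (Ideal.le_comap_pow _ _).trans ?_
  rw [Ideal.span_singleton_pow, pow_one]
  exact le_rfl

theorem prod_dz {A : Type*} [CommRing A] {t : ℕ} (ht : 1 ≤ t) (k : ℕ) :
    ∏ i ∈ Finset.range k, dz A t i = Polynomial.X ^ (k + 1 - t) := by
  induction k with
  | zero => rw [show 0 + 1 - t = 0 by omega]; simp
  | succ k ih =>
    rw [Finset.prod_range_succ, ih, dz]
    split_ifs with h
    · rw [show k + 1 - t = 0 by omega, show k + 1 + 1 - t = 0 by omega, mul_one]
    · rw [show k + 1 + 1 - t = (k + 1 - t) + 1 by omega, pow_succ]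

theorem prod_ld_VV (hmn : m ≤ n) {t s : ℕ} (ht : 1 ≤ t) (e : Fin m → ℕ)
    (h : ∏ k, ld K hmn k ^ e k ∈ VV K m n t s) : s ≤ ∑ k : Fin m, e k * ((k : ℕ) + 2 - t) := by
  rw [mem_VV] at h
  let θ : AA K m n →ₐ[K] K := aeval (Sum.elim (fun p => if p.1 = p.2 then 1 else 0)
    (fun p => if (p.1 : ℕ) = p.2 then 1 else 0))
  have h1 := map_dvd (Polynomial.mapAlgHom θ) h
  have hθ : ∀ i j, Polynomial.mapAlgHom θ (Psi K m n t (X (i, j))) = if (i : ℕ) = j then dz K t i else 0 := by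
    intro i j
    have hd : ∀ k, Polynomial.mapAlgHom θ (dz _ t k) = dz _ t k := by
      intro k; unfold dz; split_ifs <;> simp
    have hC : ∀ a, Polynomial.mapAlgHom θ (Polynomial.C a) = Polynomial.C (θ a) := by
      intro a; simp
    rw [Psi_X, map_sum, Finset.sum_eq_single i]
    · simp only [map_mul, hd, hC, θ, aeval_X, Sum.elim_inl, Sum.elim_inr, if_true]
      split_ifs <;> simp
    · intro b _ hb
      simp only [map_mul, hd, hC, θ, aeval_X, Sum.elim_inl, Sum.elim_inr, if_neg hb.symm]
      simp
    · simp
  have hld : ∀ k : Fin m, Polynomial.mapAlgHom θ (Psi K m n t (ld K hmn k)) = Polynomial.X ^ ((k : ℕ) + 2 - t) := by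
    intro k
    rw [ld, mnr, AlgHom.map_det, AlgHom.map_det]
    have e : (Polynomial.mapAlgHom θ).mapMatrix ((Psi K m n t).mapMatrix
      (Matrix.of fun (i j : Fin ((k : ℕ) + 1)) => X (Fin.castLE k.2 i, Fin.castLE ((Nat.succ_le_of_lt k.2).trans hmn) j)))
      = Matrix.diagonal (fun i : Fin ((k : ℕ) + 1) => dz K t i) := by
      ext1 i j
      simp only [AlgHom.mapMatrix_apply, Matrix.map_apply, Matrix.of_apply, hθ, Fin.val_castLE,
        Matrix.diagonal_apply, Fin.ext_iff]
    rw [e, Matrix.det_diagonal, ← Finset.prod_range (fun i => dz K t i), prod_dz ht]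
  simp only [map_prod, map_pow, hld] at h1
  simp only [← pow_mul, Finset.prod_pow_eq_pow_sum] at h1
  have hX : Polynomial.mapAlgHom θ Polynomial.X = Polynomial.X := by simp
  rw [hX] at h1
  have h2 := (pow_dvd_pow_iff Polynomial.X_ne_zero Polynomial.not_isUnit_X).1 h1
  refine h2.trans (le_of_eq ?_)
  exact Finset.sum_congr rfl fun k _ => mul_comm _ _
end


/-! ### Descent to the rationals -/

section
variable {K : Type*} [Field K] [CharZero K] {m n : ℕ}

theorem exists_decomp {σ ι : Type*} (b : Module.Basis ι ℚ K) (f : MvPolynomial σ K) :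
    ∃ F : ι →₀ MvPolynomial σ ℚ, f = F.sum fun i p => C (b i) * map (algebraMap ℚ K) p := by
  induction f using MvPolynomial.induction_on' with
  | monomial α a =>
    refine ⟨(b.repr a).mapRange (monomial α) (map_zero _), ?_⟩
    rw [Finsupp.sum_mapRange_index (by simp)]
    conv_lhs => rw [← b.linearCombination_repr a, Finsupp.linearCombination_apply, Finsupp.sum, map_sum]
    refine Finset.sum_congr rfl fun i _ => ?_
    show monomial α ((b.repr a) i • b i) = C (b i) * MvPolynomial.map (algebraMap ℚ K) (monomial α (b.repr a i))
    rw [map_monomial, C_mul_monomial, Algebra.smul_def, mul_comm]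
  | add p q hp hq =>
    obtain ⟨F, hF⟩ := hp
    obtain ⟨G, hG⟩ := hq
    refine ⟨F + G, ?_⟩
    rw [Finsupp.sum_add_index' (by simp) (by intro i p q; rw [map_add, mul_add]), ← hF, ← hG]

theorem Psi_map (t : ℕ) (p : MvPolynomial (Fin m × Fin n) ℚ) :
    Psi K m n t (MvPolynomial.map (algebraMap ℚ K) p) =
      Polynomial.map (MvPolynomial.map (algebraMap ℚ K)) (Psi ℚ m n t p) := by
  induction p using MvPolynomial.induction_on with
  | C a =>
    have h1 : Psi K m n t (C (algebraMap ℚ K a)) = Polynomial.C (C (algebraMap ℚ K a)) := by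
      rw [← algebraMap_eq, AlgHom.commutes]; rfl
    have h2 : Psi ℚ m n t (C a) = Polynomial.C (C a) := by
      rw [← algebraMap_eq, AlgHom.commutes]; rfl
    rw [map_C, h1, h2, Polynomial.map_C, map_C]
  | add p q hp hq => rw [map_add, map_add, map_add, Polynomial.map_add, hp, hq]
  | mul_X f p hp =>
    have hd : ∀ k, Polynomial.map (MvPolynomial.map (algebraMap ℚ K)) (dz (AA ℚ m n) t k) = dz (AA K m n) t k := by
      intro k; unfold dz; split_ifs <;> simp
    rw [map_mul, map_mul, map_mul, Polynomial.map_mul, hp, map_X, Psi_X, Psi_X, Polynomial.map_sum]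
    refine congrArg _ (Finset.sum_congr rfl fun k _ => ?_)
    rw [Polynomial.map_mul, Polynomial.map_mul, hd, Polynomial.map_C, Polynomial.map_C, map_X, map_X]

theorem VV_descent (t s : ℕ) (B : Ideal (MvPolynomial (Fin m × Fin n) ℚ))
    (hB : VV ℚ m n t s ≤ B) : VV K m n t s ≤ B.map (MvPolynomial.map (algebraMap ℚ K)) := by
  intro f hf
  let b := Module.Basis.ofVectorSpace ℚ K
  obtain ⟨F, hF⟩ := exists_decomp b f
  rw [mem_VV, Polynomial.X_pow_dvd_iff] at hf
  have key : ∀ i, F i ∈ VV ℚ m n t s := by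
    intro i
    rw [mem_VV, Polynomial.X_pow_dvd_iff]
    intro d hd
    ext α
    have h1 := congrArg (coeff α) (hf d hd)
    have hC : ∀ a : K, Psi K m n t (C a) = Polynomial.C (C a) := fun a => by
      rw [← algebraMap_eq, AlgHom.commutes]; rfl
    rw [hF, Finsupp.sum, map_sum, Polynomial.finsetSum_coeff, coeff_sum, coeff_zero] at h1
    simp only [map_mul, hC, Psi_map, Polynomial.coeff_C_mul, coeff_C_mul, Polynomial.coeff_map, coeff_map] at h1
    have h2 := b.linearIndependent
    rw [linearIndependent_iff'] at h2
    by_cases hi : i ∈ F.support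
    · refine h2 F.support (fun i => coeff α ((Psi ℚ m n t (F i)).coeff d)) ?_ i hi
      rw [← h1]
      refine Finset.sum_congr rfl fun j _ => ?_
      rw [Algebra.smul_def, mul_comm]
    · rw [Finsupp.notMem_support_iff.1 hi]; simp
  rw [hF, Finsupp.sum]
  exact Ideal.sum_mem _ fun i _ => Ideal.mul_mem_left _ _ (Ideal.mem_map_of_mem _ (hB (key i)))

theorem VV_le (hmn : m ≤ n) {t : ℕ} (ht : 1 ≤ t) (s a r : ℕ)
    (h : ∀ e : Fin m → ℕ, s ≤ ∑ k : Fin m, e k * ((k : ℕ) + 2 - t) →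
      ∏ k, ld ℚ hmn k ^ e k ∈ mm ℚ m n ^ a * genericMinors ℚ m n t ^ r) :
    VV K m n t s ≤ mm K m n ^ a * genericMinors K m n t ^ r := by
  have h1 : VV ℚ m n t s ≤ mm ℚ m n ^ a * genericMinors ℚ m n t ^ r := by
    refine main_lemma hmn ((VV ℚ m n t s).restrictScalars ℚ)
      ((mm ℚ m n ^ a * genericMinors ℚ m n t ^ r).restrictScalars ℚ) ?_ ?_ ?_
    · intro g h f hf
      exact VV_gsub t s g h f hf
    · intro g h f hf
      have h2 : (mm ℚ m n ^ a * genericMinors ℚ m n t ^ r).map (gsub g h) ≤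
          mm ℚ m n ^ a * genericMinors ℚ m n t ^ r := by
        rw [Ideal.map_mul, Ideal.map_pow, Ideal.map_pow]
        exact Ideal.mul_mono (Ideal.pow_right_mono (map_gsub_mm g h) _)
          (Ideal.pow_right_mono (map_gsub_minors t g h) _)
      exact h2 (Ideal.mem_map_of_mem _ hf)
    · intro e he
      exact h e (prod_ld_VV hmn ht e he)
  refine (VV_descent t s _ h1).trans ?_
  rw [Ideal.map_mul, Ideal.map_pow, Ideal.map_pow]
  refine Ideal.mul_mono (Ideal.pow_right_mono ?_ _) (Ideal.pow_right_mono ?_ _)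
  · rw [Ideal.map_le_iff_le_comap, Ideal.span_le]
    rintro _ ⟨p, rfl⟩
    show MvPolynomial.map (algebraMap ℚ K) (X p) ∈ mm K m n
    rw [map_X]
    exact Ideal.subset_span ⟨p, rfl⟩
  · rw [Ideal.map_le_iff_le_comap]
    refine minors_le fun A D => ?_
    rw [Ideal.mem_comap]
    have : MvPolynomial.map (algebraMap ℚ K) (mnr ℚ A D) = mnr K A D := by
      rw [mnr, RingHom.map_det, mnr]
      refine congrArg _ ?_
      ext1 i j
      simp
    rw [this]
    exact mnr_mem A D

theorem minors_anti {K : Type*} [Field K] {a b : ℕ} (h : a ≤ b) : genericMinors K m n b ≤ genericMinors K m n a := by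
  obtain ⟨c, rfl⟩ := Nat.exists_eq_add_of_le h
  exact (minors_add_le a c).trans Ideal.mul_le_right

theorem minors_eq_VV (hmn : m ≤ n) {t : ℕ} (ht : 1 ≤ t) (htm : t ≤ m) :
    genericMinors K m n t = VV K m n t 1 := by
  refine le_antisymm (minors_le_VV ht htm) ?_
  have := VV_le (K := K) hmn ht 1 0 1 (fun e he => ?_)
  · simpa using this
  · rw [pow_zero, pow_one, Ideal.one_eq_top, Ideal.top_mul]
    have hne : ∑ k : Fin m, e k * ((k : ℕ) + 2 - t) ≠ 0 := by omega
    obtain ⟨k, _, hk⟩ := Finset.exists_ne_zero_of_sum_ne_zero hne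
    have h1 : e k ≠ 0 := left_ne_zero_of_mul hk
    have h2 : (k : ℕ) + 2 - t ≠ 0 := right_ne_zero_of_mul hk
    refine Ideal.mem_of_dvd _ (Finset.dvd_prod_of_mem _ (Finset.mem_univ k)) ?_
    refine Ideal.pow_mem_of_mem _ ?_ _ (Nat.pos_of_ne_zero h1)
    exact minors_anti (show t ≤ (k : ℕ) + 1 by omega) (mnr_mem _ _)

theorem prod_minors_le' {ι : Type*} [Fintype ι] (t : ℕ) (σ : ι → ℕ) (h : Fintype.card ι * t ≤ ∑ i, σ i) :
    ∏ i, genericMinors K m n (σ i) ≤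
      mm K m n ^ (∑ i, σ i - Fintype.card ι * t) * genericMinors K m n t ^ Fintype.card ι := by
  let f := (Fintype.equivFin ι).symm
  have h1 : ∑ i, σ (f i) = ∑ i, σ i := Equiv.sum_comp f σ
  have h2 : ∏ i, genericMinors K m n (σ (f i)) = ∏ i, genericMinors K m n (σ i) :=
    Equiv.prod_comp f (fun i => genericMinors K m n (σ i))
  have := prod_minors_le (K := K) (m := m) (n := n) t (Fintype.card ι) _ (fun i => σ (f i)) rfl (by rw [h1]; exact h)
  rwa [h1, h2] at this

theorem prod_minors_le_pow {ι : Type*} [Fintype ι] (t N r : ℕ) (σ : ι → ℕ) (hσ : ∀ i, t ≤ σ i)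
    (h : (N + t) * r ≤ ∑ i, σ i) :
    ∏ i, genericMinors K m n (σ i) ≤ mm K m n ^ (N * r) * genericMinors K m n t ^ r := by
  have hcs : Fintype.card ι * t ≤ ∑ i, σ i := by
    have := Finset.sum_le_sum (s := Finset.univ) fun i _ => hσ i
    simpa using this
  rw [add_mul] at h
  rcases le_or_gt (Fintype.card ι) r with hc | hc
  · let τ : ι ⊕ Fin (r - Fintype.card ι) → ℕ := Sum.elim σ (fun _ => 0)
    have hcard : Fintype.card (ι ⊕ Fin (r - Fintype.card ι)) = r := by simp; omega
    have hsum : ∑ i, τ i = ∑ i, σ i := by simp [τ]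
    have hprod : ∏ i, genericMinors K m n (τ i) = ∏ i, genericMinors K m n (σ i) := by
      simp [τ, Fintype.prod_sum_type, minors_zero, ← Ideal.one_eq_top]
    have h1 := prod_minors_le' (K := K) (m := m) (n := n) t τ (by rw [hcard, hsum, mul_comm]; omega)
    rw [hcard, hsum, hprod] at h1
    refine h1.trans (Ideal.mul_mono_left (Ideal.pow_le_pow_right ?_))
    rw [mul_comm r t]; omega
  · have h1 := prod_minors_le' (K := K) (m := m) (n := n) t σ hcs
    refine h1.trans ?_
    obtain ⟨d, hd⟩ := Nat.exists_eq_add_of_lt hc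
    have h2 : genericMinors K m n t ^ (d + 1) ≤ mm K m n ^ (t * (d + 1)) := by
      rw [pow_mul]; exact Ideal.pow_right_mono (minors_le_pow t) _
    rw [hd, show r + d + 1 = (d + 1) + r by ring, pow_add, ← mul_assoc]
    refine Ideal.mul_mono_left ?_
    refine (Ideal.mul_mono_right h2).trans ?_
    rw [← pow_add]
    refine Ideal.pow_le_pow_right ?_
    have e1 : (d + 1 + r) * t = t * (d + 1) + t * r := by ring
    have e2 : Fintype.card ι * t = t * (d + 1) + t * r := by rw [hd]; ring
    rw [e1]; omega

theorem VV_le_pow (hmn : m ≤ n) {t : ℕ} (ht : 1 ≤ t) (htm : t ≤ m) (N s r : ℕ)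
    (hs : (N + t) * (m - t + 1) * r < s * m) :
    VV K m n t s ≤ mm K m n ^ (N * r) * genericMinors K m n t ^ r := by
  refine VV_le hmn ht s _ _ fun e he => ?_
  let e1 : Fin m → ℕ := fun k => if t ≤ (k : ℕ) + 1 then e k else 0
  let e2 : Fin m → ℕ := fun k => if t ≤ (k : ℕ) + 1 then 0 else e k
  have he12 : ∀ k, e k = e1 k + e2 k := by
    intro k; simp only [e1, e2]; split_ifs <;> simp
  have hsplit : ∏ k, ld ℚ hmn k ^ e k = (∏ k, ld ℚ hmn k ^ e1 k) * ∏ k, ld ℚ hmn k ^ e2 k := by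
    rw [← Finset.prod_mul_distrib]
    exact Finset.prod_congr rfl fun k _ => by rw [he12, pow_add]
  rw [hsplit]
  refine Ideal.mul_mem_right _ _ ?_
  have hsum : ∑ x : (Σ k : Fin m, Fin (e1 k)), ((x.1 : ℕ) + 1) = ∑ k : Fin m, e1 k * ((k : ℕ) + 1) := by
    rw [Fintype.sum_sigma]; simp
  have hprod : ∏ x : (Σ k : Fin m, Fin (e1 k)), ld ℚ hmn x.1 = ∏ k, ld ℚ hmn k ^ e1 k := by
    rw [Fintype.prod_sigma]; simp
  rw [← hprod]
  refine prod_minors_le_pow (ι := Σ k : Fin m, Fin (e1 k)) t N r (fun x => (x.1 : ℕ) + 1) ?_ ?_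
    (Ideal.prod_mem_prod fun x _ => mnr_mem _ _)
  · rintro ⟨k, i⟩
    by_contra hk
    have : e1 k = 0 := if_neg hk
    rw [this] at i
    exact i.elim0
  · rw [hsum]
    have h1 : m * ∑ k : Fin m, e k * ((k : ℕ) + 2 - t) ≤ (∑ k : Fin m, e1 k * ((k : ℕ) + 1)) * (m - t + 1) := by
      rw [Finset.mul_sum, Finset.sum_mul]
      refine Finset.sum_le_sum fun k _ => ?_
      simp only [e1]
      split_ifs with hk
      · obtain ⟨c, hc⟩ := Nat.exists_eq_add_of_le hk
        obtain ⟨d, hd⟩ := Nat.exists_eq_add_of_le (Nat.succ_le_of_lt k.2)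
        obtain ⟨u, rfl⟩ := Nat.exists_eq_add_of_le ht
        have hk' : (k : ℕ) = u + c := by omega
        have hm' : m = u + c + 1 + d := by omega
        have e1 : (k : ℕ) + 2 - (1 + u) = c + 1 := by omega
        have e2 : m - (1 + u) + 1 = c + d + 1 := by omega
        rw [e1, e2, hk']
        have : m * (c + 1) ≤ (u + c + 1) * (c + d + 1) := by
          rw [hm']; nlinarith [Nat.zero_le (u * d)]
        calc m * (e k * (c + 1)) = e k * (m * (c + 1)) := by ring
          _ ≤ e k * ((u + c + 1) * (c + d + 1)) := Nat.mul_le_mul_left _ this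
          _ = _ := by ring
      · rw [show (k : ℕ) + 2 - t = 0 by omega]; simp
    have h2 : (N + t) * r * (m - t + 1) < (∑ k : Fin m, e1 k * ((k : ℕ) + 1)) * (m - t + 1) := by
      calc (N + t) * r * (m - t + 1) = (N + t) * (m - t + 1) * r := by ring
        _ < s * m := hs
        _ ≤ m * ∑ k : Fin m, e k * ((k : ℕ) + 2 - t) := by rw [mul_comm]; exact Nat.mul_le_mul_left _ he
        _ ≤ _ := h1
    exact (Nat.lt_of_mul_lt_mul_right h2).le
end


/-! ### Symbolic powers and the final computation -/

theorem mem_symb {R : Type*} [CommRing R] [IsNoetherianRing R] (I : Ideal R) [hI : I.IsPrime] (s : ℕ) (f : R) :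
    f ∈ symbolicPower I s ↔ ∃ u, u ∉ I ∧ u * f ∈ I ^ s := by
  have hass : associatedPrimes R (R ⧸ I) = {I} := by
    rw [associatedPrimes.eq_singleton_of_isPrimary hI.isPrimary, hI.radical]
  have hmem : ∀ p : Ideal R, p ∈ associatedPrimes R (R ⧸ I) ↔ p = I := by
    intro p; rw [hass, Set.mem_singleton_iff]
  have key : ∀ (p : Ideal R) [p.IsPrime], p = I → (f ∈ Ideal.comap (algebraMap R (Localization.AtPrime p))
      (Ideal.map (algebraMap R (Localization.AtPrime p)) (I ^ s)) ↔ ∃ u, u ∉ I ∧ u * f ∈ I ^ s) := by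
    intro p _ hp
    subst hp
    rw [Ideal.mem_comap, IsLocalization.algebraMap_mem_map_algebraMap_iff p.primeCompl]
    rfl
  unfold symbolicPower
  rw [Ideal.mem_iInf]
  constructor
  · intro h
    have h1 := h ⟨I, (hmem I).2 rfl⟩
    exact (key I rfl).1 h1
  · rintro h ⟨p, hp⟩
    have : p.IsPrime := hp.isPrime
    exact (key p ((hmem p).1 hp)).2 h

section
variable {K : Type*} [Field K] [CharZero K] {m n : ℕ}

theorem minors_prime (hmn : m ≤ n) {t : ℕ} (ht : 1 ≤ t) (htm : t ≤ m) :
    (genericMinors K m n t).IsPrime := by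
  rw [minors_eq_VV hmn ht htm]; exact VV_prime t

theorem symb_le (hmn : m ≤ n) {t : ℕ} (ht : 1 ≤ t) (htm : t ≤ m) (N s r : ℕ)
    (hs : (N + t) * (m - t + 1) * r < s * m) :
    symbolicPower (genericMinors K m n t) s ≤ (mm K m n ^ N * genericMinors K m n t) ^ r := by
  have := minors_prime (K := K) hmn ht htm
  rw [mul_pow, ← pow_mul]
  refine le_trans ?_ (VV_le_pow hmn ht htm N s r hs)
  intro f hf
  rw [mem_symb] at hf
  obtain ⟨u, hu, huf⟩ := hf
  rw [minors_eq_VV hmn ht htm] at hu huf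
  exact VV_cancel t s hu (VV_pow t s huf)

theorem exists_small (hmn : m ≤ n) {t : ℕ} (ht : 1 ≤ t) (htm : t ≤ m) :
    ∃ v ∈ genericMinors K m n (t - 1), v ∉ genericMinors K m n t := by
  have hp := minors_prime (K := K) hmn ht htm
  rcases Nat.lt_or_ge t 2 with h | h
  · have : t - 1 = 0 := by omega
    rw [this, minors_zero]
    exact ⟨1, trivial, fun h => hp.ne_top ((Ideal.eq_top_iff_one _).2 h)⟩
  · let k : Fin m := ⟨t - 2, by omega⟩
    refine ⟨ld K hmn k, ?_, ?_⟩
    · have : t - 1 = (k : ℕ) + 1 := by simp only [k]; omega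
      rw [this]; exact mnr_mem _ _
    · rw [minors_eq_VV hmn ht htm]
      intro hk
      have e : ∏ j, ld K hmn j ^ (Pi.single k 1 : Fin m → ℕ) j = ld K hmn k := by
        rw [Finset.prod_eq_single k]
        · simp
        · intro b _ hb; simp [hb]
        · simp
      rw [← e] at hk
      have h1 := prod_ld_VV hmn ht _ hk
      rw [Finset.sum_eq_zero] at h1
      · omega
      · intro j _
        by_cases hj : j = k
        · subst hj
          have : (k : ℕ) + 2 - t = 0 := by simp only [k]; omega
          rw [this, mul_zero]
        · simp [hj]

theorem exists_witness (hmn : m ≤ n) {t : ℕ} (ht : 1 ≤ t) (htm : t ≤ m) (D : MvPolynomial (Fin m × Fin n) K)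
    (hD : D ∈ genericMinors K m n m) :
    ∃ w, w ∉ genericMinors K m n t ∧ w * D ∈ genericMinors K m n t ^ (m - t + 1) := by
  have hp := minors_prime (K := K) hmn ht htm
  obtain ⟨v, hv, hvI⟩ := exists_small (K := K) hmn ht htm
  refine ⟨v ^ (m - t), fun h => hvI (hp.mem_of_pow_mem _ h), ?_⟩
  let σ : Option (Fin (m - t)) → ℕ := fun o => o.elim m (fun _ => t - 1)
  have hsum : ∑ i, σ i = m + (m - t) * (t - 1) := by
    rw [Fintype.sum_option]; simp [σ]
  have hcard : Fintype.card (Option (Fin (m - t))) = m - t + 1 := by simp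
  have hprod : ∏ i, genericMinors K m n (σ i) = genericMinors K m n m * genericMinors K m n (t - 1) ^ (m - t) := by
    rw [Fintype.prod_option]; simp [σ]
  have h1 := prod_minors_le' (K := K) (m := m) (n := n) t σ (by
    rw [hcard, hsum]
    obtain ⟨u, rfl⟩ := Nat.exists_eq_add_of_le ht
    obtain ⟨d, hd⟩ := Nat.exists_eq_add_of_le htm
    rw [show m - (1 + u) = d by omega, show 1 + u - 1 = u by omega]
    nlinarith)
  rw [hprod, hcard] at h1
  have h2 := h1.trans Ideal.mul_le_right
  apply h2
  rw [mul_comm (v ^ (m - t)) D]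
  exact Ideal.mul_mem_mul hD (Ideal.pow_mem_pow hv _)

theorem exists_D (hmn : m ≤ n) (hm : 1 ≤ m) : ∃ D ∈ genericMinors K m n m,
    ∀ k d : ℕ, D ^ k ∈ mm K m n ^ d → d ≤ m * k := by
  let j : Fin m := ⟨m - 1, by omega⟩
  have hj : (j : ℕ) + 1 = m := by simp only [j]; omega
  refine ⟨ld K hmn j, ?_, ?_⟩
  · have : ld K hmn j ∈ genericMinors K m n ((j : ℕ) + 1) := mnr_mem _ _
    rwa [hj] at this
  · intro k d h
    let φ : MvPolynomial (Fin m × Fin n) K →ₐ[K] Polynomial K :=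
      aeval fun p => if (p.1 : ℕ) = p.2 then Polynomial.X else 0
    have hφ : φ (ld K hmn j) = Polynomial.X ^ m := by
      rw [ld, mnr, AlgHom.map_det]
      have e : φ.mapMatrix
        (Matrix.of fun (i l : Fin ((j : ℕ) + 1)) => X (Fin.castLE j.2 i, Fin.castLE ((Nat.succ_le_of_lt j.2).trans hmn) l))
        = Matrix.diagonal (fun i : Fin ((j : ℕ) + 1) => Polynomial.X) := by
        ext1 i l
        simp only [AlgHom.mapMatrix_apply, Matrix.map_apply, Matrix.of_apply, φ, aeval_X, Fin.val_castLE,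
          Matrix.diagonal_apply, Fin.ext_iff]
      rw [e, Matrix.det_diagonal, Finset.prod_const, Finset.card_univ, Fintype.card_fin, hj]
    have hmm : mm K m n ≤ Ideal.comap φ (Ideal.span {Polynomial.X}) := by
      rw [Ideal.span_le]
      rintro _ ⟨p, rfl⟩
      show φ (X p) ∈ Ideal.span {Polynomial.X}
      simp only [φ, aeval_X]
      split_ifs
      · exact Ideal.mem_span_singleton_self _
      · exact Ideal.zero_mem _
    have h1 := (Ideal.le_comap_pow _ _) ((Ideal.pow_right_mono hmm d) h)
    rw [Ideal.mem_comap, Ideal.span_singleton_pow, Ideal.mem_span_singleton, map_pow, hφ, ← pow_mul] at h1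
    exact (pow_dvd_pow_iff Polynomial.X_ne_zero Polynomial.not_isUnit_X).1 h1

theorem symb_not_le (hmn : m ≤ n) {t : ℕ} (ht : 1 ≤ t) (htm : t ≤ m) (N s r : ℕ)
    (hs : s * m < (N + t) * (m - t + 1) * r) : ∀ᶠ T in atTop,
    ¬ symbolicPower (genericMinors K m n t) (s * T) ≤ (mm K m n ^ N * genericMinors K m n t) ^ (r * T) := by
  have hp := minors_prime (K := K) hmn ht htm
  obtain ⟨D, hD, hDm⟩ := exists_D (K := K) hmn (ht.trans htm)
  obtain ⟨w, hw, hwD⟩ := exists_witness hmn ht htm D hD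
  set q := m - t + 1 with hq
  filter_upwards [eventually_gt_atTop (q * m)] with T hT hle
  set k := s * T / q + 1 with hk
  have hk1 : s * T ≤ q * k := by
    have := Nat.div_add_mod (s * T) q
    have := Nat.mod_lt (s * T) (show 0 < q by omega)
    rw [hk, mul_add]; omega
  have hk2 : q * k ≤ s * T + q := by
    have := Nat.div_add_mod (s * T) q
    rw [hk, mul_add]; omega
  have hmem : D ^ k ∈ symbolicPower (genericMinors K m n t) (s * T) := by
    rw [mem_symb]
    refine ⟨w ^ k, fun h => hw (hp.mem_of_pow_mem _ h), ?_⟩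
    rw [← mul_pow]
    have := Ideal.pow_mem_pow hwD k
    rw [← pow_mul] at this
    exact Ideal.pow_le_pow_right hk1 this
  have h1 := hle hmem
  have h2 : (mm K m n ^ N * genericMinors K m n t) ^ (r * T) ≤ mm K m n ^ ((N + t) * (r * T)) := by
    rw [pow_mul _ (N + t)]
    refine Ideal.pow_right_mono ?_ _
    rw [pow_add]
    exact Ideal.mul_mono_right (minors_le_pow t)
  have h3 := hDm _ _ (h2 h1)
  have h4 : (N + t) * q * r * T ≤ (s * T + q) * m := by
    calc (N + t) * q * r * T = q * ((N + t) * (r * T)) := by ring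
      _ ≤ q * (m * k) := Nat.mul_le_mul_left _ h3
      _ = q * k * m := by ring
      _ ≤ _ := Nat.mul_le_mul_right _ hk2
  have h5 : (s * m + 1) * T ≤ (N + t) * q * r * T := Nat.mul_le_mul_right _ hs
  nlinarith
end

theorem sSup_eq_aux (P m : ℕ) (hP : 0 < P) (hm : 0 < m) (S : Set ℝ)
    (h1 : ∀ x ∈ S, ∃ s r : ℕ, 0 < s ∧ 0 < r ∧ x = (s : ℝ) / r ∧ s * m ≤ P * r)
    (h2 : ∀ s r : ℕ, 0 < s → 0 < r → s * m < P * r → (s : ℝ) / r ∈ S) : sSup S = (P : ℝ) / m := by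
  have hm' : (0 : ℝ) < m := by exact_mod_cast hm
  have hex : ∀ w < (P : ℝ) / m, ∃ a ∈ S, w < a := by
    intro w hw
    have h0 : max w 0 < (P : ℝ) / m := max_lt hw (by positivity)
    obtain ⟨x, hx1, hx2⟩ := exists_rat_btwn h0
    have hx0 : (0 : ℝ) < x := (le_max_right _ _).trans_lt hx1
    have hx0' : 0 < x := by exact_mod_cast hx0
    have hnum : 0 < x.num := Rat.num_pos.2 hx0'
    have hxe : (x : ℝ) = (x.num.toNat : ℝ) / (x.den : ℝ) := by
      have e1 : ((x.num.toNat : ℤ)) = x.num := Int.toNat_of_nonneg hnum.le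
      have e2 : (x.num.toNat : ℝ) = (x.num : ℝ) := by exact_mod_cast congrArg (fun z : ℤ => (z : ℝ)) e1
      rw [e2, Rat.cast_def]
    have hden : (0 : ℝ) < x.den := by exact_mod_cast x.den_pos
    refine ⟨x, ?_, (le_max_left _ _).trans_lt hx1⟩
    rw [hxe]
    refine h2 _ _ (by omega) x.den_pos ?_
    rw [hxe, div_lt_div_iff₀ hden hm'] at hx2
    exact_mod_cast hx2
  refine csSup_eq_of_forall_le_of_forall_lt_exists_gt ?_ ?_ hex
  · obtain ⟨a, ha, _⟩ := hex 0 (by positivity)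
    exact ⟨a, ha⟩
  · intro x hx
    obtain ⟨s, r, _, hr, rfl, h⟩ := h1 x hx
    have hr' : (0 : ℝ) < r := by exact_mod_cast hr
    rw [div_le_div_iff₀ hr' hm']
    exact_mod_cast h

theorem generic_determinantal_pair_resurgence {K : Type*} [Field K] [CharZero K]
    (m n t : ℕ) (hmn : m ≤ n) (ht1 : 1 ≤ t) (htm : t ≤ m) (N : ℕ)
    (hfac : IsUnit (((min t (m - t)).factorial : K))) :
    let 𝔪 : Ideal (MvPolynomial (Fin m × Fin n) K) := Ideal.span (Set.range MvPolynomial.X)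
    resurgencePair (fun s => symbolicPower (genericMinors K m n t) s)
        (fun r => (𝔪 ^ N * genericMinors K m n t) ^ r)
      = ((N + t) * (m - t + 1) : ℕ) / (m : ℝ) ∧
    asympResurgencePair (fun s => symbolicPower (genericMinors K m n t) s)
        (fun r => (𝔪 ^ N * genericMinors K m n t) ^ r)
      = ((N + t) * (m - t + 1) : ℕ) / (m : ℝ) := by
  intro 𝔪
  have hP : 0 < (N + t) * (m - t + 1) := Nat.mul_pos (by omega) (by omega)
  have hm : 0 < m := by omega
  have hup : ∀ s r : ℕ, ¬ symbolicPower (genericMinors K m n t) s ≤ (𝔪 ^ N * genericMinors K m n t) ^ r →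
      s * m ≤ (N + t) * (m - t + 1) * r := by
    intro s r h
    by_contra hcon
    exact h (symb_le hmn ht1 htm N s r (not_le.1 hcon))
  constructor
  · refine sSup_eq_aux _ m hP hm _ ?_ ?_
    · rintro x ⟨s, r, hs, hr, hx, h⟩
      exact ⟨s, r, hs, hr, hx, hup s r h⟩
    · intro s r hs hr h
      obtain ⟨T, hT, hT0⟩ := ((symb_not_le (K := K) hmn ht1 htm N s r h).and (eventually_gt_atTop 0)).exists
      refine ⟨s * T, r * T, Nat.mul_pos hs hT0, Nat.mul_pos hr hT0, ?_, hT⟩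
      have : (T : ℝ) ≠ 0 := by exact_mod_cast hT0.ne'
      push_cast
      rw [mul_div_mul_right _ _ this]
  · refine sSup_eq_aux _ m hP hm _ ?_ ?_
    · rintro x ⟨s, r, hs, hr, hx, h⟩
      obtain ⟨T, hT, hT0⟩ := (h.and (eventually_gt_atTop 0)).exists
      refine ⟨s, r, hs, hr, hx, ?_⟩
      have h1 := hup _ _ hT
      refine Nat.le_of_mul_le_mul_right (c := T) ?_ hT0
      calc s * m * T = s * T * m := by ring
        _ ≤ _ := h1
        _ = _ := by ring
    · intro s r hs hr h
      exact ⟨s, r, hs, hr, rfl, symb_not_le (K := K) hmn ht1 htm N s r h⟩
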